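/- Let β ∈ ℝ and 0 < α < 8/(d+n). For all c₁, c₂ > 0 one has the subadditivity m_{c₁+c₂} ≤ m_{c₁} + m_{c₂}. -/

import Mathlib

noncomputable section

open MeasureTheory Real Filter Set

namespace BNLS

/-- A point of `ℝ^d × 𝕋^n`, the torus being modelled by periodic functions on `ℝ^n`. -/
abbrev Pt (d n : ℕ) := (Fin d → ℝ) × (Fin n → ℝ)

/-- Fundamental domain `[0,2π)^n` of the torus `(ℝ/2πℤ)^n`. -/
def torusBox (n : ℕ) : Set (Fin n → ℝ) := Set.univ.pi fun _ => Set.Ico 0 (2*π)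

/-- The measure of the torus `𝕋^n`. -/
def μT (n : ℕ) : Measure (Fin n → ℝ) := volume.restrict (torusBox n)

/-- The measure of `ℝ^d × 𝕋^n`. -/
def μP (d n : ℕ) : Measure (Pt d n) := (volume : Measure (Fin d → ℝ)).prod (μT n)

/-- Partial derivative in the `i`-th `x`-direction. -/
def dX (d n : ℕ) (i : Fin d) (u : Pt d n → ℂ) : Pt d n → ℂ :=
  fun p => fderiv ℝ u p (Pi.single i 1, 0)

/-- Partial derivative in the `j`-th `y`-direction. -/
def dY (d n : ℕ) (j : Fin n) (u : Pt d n → ℂ) : Pt d n → ℂ :=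
  fun p => fderiv ℝ u p (0, Pi.single j 1)

/-- Partial Laplacian `Δ_x`. -/
def lapX (d n : ℕ) (u : Pt d n → ℂ) : Pt d n → ℂ := fun p => ∑ i, dX d n i (dX d n i u) p

/-- Partial Laplacian `Δ_y`. -/
def lapY (d n : ℕ) (u : Pt d n → ℂ) : Pt d n → ℂ := fun p => ∑ j, dY d n j (dY d n j u) p

/-- Full Laplacian `Δ_{x,y}`. -/
def lap (d n : ℕ) (u : Pt d n → ℂ) : Pt d n → ℂ := fun p => lapX d n u p + lapY d n u p

/-- Mass `‖u‖_{L²}²`. -/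
def Mass (d n : ℕ) (u : Pt d n → ℂ) : ℝ := ∫ z, ‖u z‖^2 ∂(μP d n)

/-- `‖u‖_{L^p}^p`. -/
def Npow (d n : ℕ) (p : ℝ) (u : Pt d n → ℂ) : ℝ := ∫ z, ‖u z‖ ^ p ∂(μP d n)

/-- The `L^p` norm. -/
def LpN (d n : ℕ) (p : ℝ) (u : Pt d n → ℂ) : ℝ := (Npow d n p u) ^ (1/p)

/-- `‖Δ u‖_{L²}²`. -/
def lapSq (d n : ℕ) (u : Pt d n → ℂ) : ℝ := ∫ z, ‖lap d n u z‖^2 ∂(μP d n)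

/-- `‖Δ_x u‖_{L²}²`. -/
def lapXSq (d n : ℕ) (u : Pt d n → ℂ) : ℝ := ∫ z, ‖lapX d n u z‖^2 ∂(μP d n)

/-- `‖Δ_y u‖_{L²}²`. -/
def lapYSq (d n : ℕ) (u : Pt d n → ℂ) : ℝ := ∫ z, ‖lapY d n u z‖^2 ∂(μP d n)

/-- `‖∇_x u‖_{L²}²`. -/
def gradXSq (d n : ℕ) (u : Pt d n → ℂ) : ℝ := ∫ z, (∑ i, ‖dX d n i u z‖^2) ∂(μP d n)

/-- `‖∇_y u‖_{L²}²`. -/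
def gradYSq (d n : ℕ) (u : Pt d n → ℂ) : ℝ := ∫ z, (∑ j, ‖dY d n j u z‖^2) ∂(μP d n)

/-- `‖∇ u‖_{L²}²`. -/
def gradSq (d n : ℕ) (u : Pt d n → ℂ) : ℝ := gradXSq d n u + gradYSq d n u

/-- Pointwise sum of squares of all second derivatives. -/
def hessInt (d n : ℕ) (u : Pt d n → ℂ) (z : Pt d n) : ℝ :=
  (∑ i, ∑ i', ‖dX d n i (dX d n i' u) z‖^2) + (∑ i, ∑ j, ‖dY d n j (dX d n i u) z‖^2)
  + (∑ j, ∑ i, ‖dX d n i (dY d n j u) z‖^2) + (∑ j, ∑ j', ‖dY d n j (dY d n j' u) z‖^2)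

/-- `‖∇² u‖_{L²}²`. -/
def hessSq (d n : ℕ) (u : Pt d n → ℂ) : ℝ := ∫ z, hessInt d n u z ∂(μP d n)

/-- The `H²` norm on `ℝ^d × 𝕋^n`. -/
def H2norm (d n : ℕ) (u : Pt d n → ℂ) : ℝ :=
  Real.sqrt (Mass d n u + gradSq d n u + hessSq d n u)

/-- `2π`-periodicity in all `y`-variables. -/
def Periodic (d n : ℕ) (u : Pt d n → ℂ) : Prop :=
  ∀ j : Fin n, ∀ p : Pt d n, u (p.1, p.2 + (2*π) • (Pi.single j 1 : Fin n → ℝ)) = u p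

/-- Membership in `H²(ℝ^d × 𝕋^n)`. -/
def InH2 (d n : ℕ) (u : Pt d n → ℂ) : Prop :=
  ContDiff ℝ 2 u ∧ Periodic d n u ∧
  Integrable (fun z => ‖u z‖^2) (μP d n) ∧
  Integrable (fun z => (∑ i, ‖dX d n i u z‖^2) + ∑ j, ‖dY d n j u z‖^2) (μP d n) ∧
  Integrable (hessInt d n u) (μP d n)

/-- The mass sphere `S(c)`. -/
def Sset (d n : ℕ) (c : ℝ) : Set (Pt d n → ℂ) := {u | InH2 d n u ∧ Mass d n u = c}

/-- The energy functional `E`. -/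
def En (d n : ℕ) (β α : ℝ) (u : Pt d n → ℂ) : ℝ :=
  (1/2) * lapSq d n u + (β/2) * gradSq d n u - (1/(α+2)) * Npow d n (α+2) u

/-- The ground state energy `m_c`. -/
def mC (d n : ℕ) (β α c : ℝ) : ℝ := sInf (En d n β α '' Sset d n c)

end BNLS

namespace BNLS

instance : Fact (0 < 2 * π) := ⟨by positivity⟩

/-- reduce mod 2π after shift -/
def psi (b t : ℝ) : ℝ := toIocMod (p := 2*π) (by positivity) 0 (t + b)

lemma psi_mp (b : ℝ) : MeasurePreserving (psi b) (volume.restrict (Ico 0 (2*π)))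
    (volume.restrict (Ico 0 (2*π))) := by
  have h0 : volume.restrict (Ico 0 (2*π)) = volume.restrict (Ioc (0:ℝ) (0 + 2*π)) := by
    rw [zero_add]; exact Measure.restrict_congr_set Ico_ae_eq_Ioc
  rw [h0]
  have h1 := AddCircle.measurePreserving_mk (2*π) 0
  have h2 := measurePreserving_add_right (volume : Measure (AddCircle (2*π))) (b : AddCircle (2*π))
  have h3 := AddCircle.measurePreserving_equivIoc (2*π) (a := 0)
  have h4 : MeasurePreserving (Subtype.val : Ioc (0:ℝ) (0 + 2*π) → ℝ)
      (Measure.comap Subtype.val volume) (volume.restrict (Ioc (0:ℝ) (0 + 2*π))) :=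
    measurePreserving_subtype_coe measurableSet_Ioc
  have := h4.comp (h3.comp (h2.comp h1))
  exact this

lemma psi_eq (b t : ℝ) : ∃ m : ℤ, psi b t = t + b - m * (2*π) := by
  refine ⟨toIocDiv (p := 2*π) (by positivity) 0 (t + b), ?_⟩
  rw [psi, toIocMod, zsmul_eq_mul]

/-- generic periodicity -/
def PerG {d n : ℕ} {X : Type*} (u : Pt d n → X) : Prop :=
  ∀ j : Fin n, ∀ p : Pt d n, u (p.1, p.2 + (2*π) • (Pi.single j 1 : Fin n → ℝ)) = u p

lemma PerG.int {d n : ℕ} {X : Type*} {u : Pt d n → X} (h : PerG u) (m : Fin n → ℤ)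
    (x : Fin d → ℝ) (y : Fin n → ℝ) : u (x, fun j => y j - m j * (2*π)) = u (x, y) := by
  have h1 : ∀ j : Fin n, Function.Periodic u ((0, (2*π) • (Pi.single j 1 : Fin n → ℝ)) : Pt d n) := by
    intro j p
    have := h j p
    rw [← this]; congr 1; ext <;> simp
  have h2 : ∀ s : Finset (Fin n), Function.Periodic u
      (∑ j ∈ s, (m j) • ((0, (2*π) • (Pi.single j 1 : Fin n → ℝ)) : Pt d n)) := by
    intro s
    induction s using Finset.induction_on with
    | empty => intro p; simp
    | insert a s ha ih =>
      rw [Finset.sum_insert ha]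
      exact ((h1 a).zsmul (m a)).add_period ih
  have h3 := (h2 Finset.univ).sub_eq (x, y)
  rw [← h3]; congr 1
  ext k
  · simp [Prod.fst_sum]
  · simp [Prod.snd_sum, Finset.sum_apply, Pi.single_apply, mul_comm]

/-- measure preserving model of translation -/
def phi {d n : ℕ} (w : Pt d n) (z : Pt d n) : Pt d n := (z.1 + w.1, fun j => psi (w.2 j) (z.2 j))

lemma μT_eq (n : ℕ) : μT n = Measure.pi (fun _ : Fin n => volume.restrict (Ico 0 (2*π))) := by
  rw [← Measure.restrict_pi_pi]; rfl

instance (n : ℕ) : IsFiniteMeasure (μT n) := by rw [μT_eq]; infer_instance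

lemma phi_mp {d n : ℕ} (w : Pt d n) : MeasurePreserving (phi w) (μP d n) (μP d n) := by
  have h1 : MeasurePreserving (fun y : Fin n → ℝ => fun j => psi (w.2 j) (y j)) (μT n) (μT n) := by
    rw [μT_eq]
    exact measurePreserving_pi _ _ (fun j => psi_mp (w.2 j))
  exact (measurePreserving_add_right (volume : Measure (Fin d → ℝ)) w.1).prod h1

lemma PerG.phi {d n : ℕ} {X : Type*} {u : Pt d n → X} (h : PerG u) (w z : Pt d n) :
    u (phi w z) = u (z + w) := by
  choose m hm using fun j => psi_eq (w.2 j) (z.2 j)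
  have := h.int m (z.1 + w.1) (z.2 + w.2)
  simp only [BNLS.phi, hm]
  exact this

lemma PerG.integral_add {d n : ℕ} {X : Type*} [NormedAddCommGroup X] [NormedSpace ℝ X]
    {u : Pt d n → X} (h : PerG u)
    (hu : StronglyMeasurable u) (w : Pt d n) : ∫ z, u (z + w) ∂(μP d n) = ∫ z, u z ∂(μP d n) := by
  simp_rw [← h.phi w]
  have := integral_map (μ := μP d n) (phi_mp w).measurable.aemeasurable (f := u)
    hu.aestronglyMeasurable
  rw [← this, (phi_mp w).map_eq]

lemma PerG.lintegral_add {d n : ℕ} 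
    {u : Pt d n → ENNReal} (h : PerG u)
    (hu : Measurable u) (w : Pt d n) : ∫⁻ z, u (z + w) ∂(μP d n) = ∫⁻ z, u z ∂(μP d n) := by
  simp_rw [← h.phi w]
  exact (phi_mp w).lintegral_comp hu

lemma PerG.integrable_add {d n : ℕ} {X : Type*} [NormedAddCommGroup X]
    {u : Pt d n → X} (h : PerG u)
    (hu : Integrable u (μP d n)) (w : Pt d n) : Integrable (fun z => u (z + w)) (μP d n) := by
  simp_rw [← h.phi w]
  exact (phi_mp w).integrable_comp_of_integrable hu


/-- directional derivative -/
def D {d n : ℕ} (w : Pt d n) (u : Pt d n → ℂ) : Pt d n → ℂ := fun z => fderiv ℝ u z w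

/-- coordinate directions -/
def ee {d n : ℕ} : Fin d ⊕ Fin n → Pt d n :=
  Sum.elim (fun i => (Pi.single i 1, 0)) (fun j => (0, Pi.single j 1))

lemma lap_eq {d n : ℕ} (u : Pt d n → ℂ) (z : Pt d n) :
    lap d n u z = ∑ k, D (ee k) (D (ee k) u) z := by
  rw [Fintype.sum_sum_type]; rfl

lemma grad_eq {d n : ℕ} (u : Pt d n → ℂ) (z : Pt d n) :
    (∑ i, ‖dX d n i u z‖^2) + ∑ j, ‖dY d n j u z‖^2 = ∑ k, ‖D (ee k) u z‖^2 := by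
  rw [Fintype.sum_sum_type]; rfl

lemma hess_eq {d n : ℕ} (u : Pt d n → ℂ) (z : Pt d n) :
    hessInt d n u z = ∑ k, ∑ l, ‖D (ee k) (D (ee l) u) z‖^2 := by
  simp only [Fintype.sum_sum_type, Finset.sum_add_distrib, hessInt]
  rw [Finset.sum_comm (f := fun i j => ‖dY d n j (dX d n i u) z‖^2),
    Finset.sum_comm (f := fun j i => ‖dX d n i (dY d n j u) z‖^2)]
  have : ∀ a b c e : ℝ, a + b + c + e = a + b + (c + e) := by intros; ring
  exact this _ _ _ _

/-- regular, periodic, compactly supported in x -/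
structure Nice {d n : ℕ} (m : ℕ) (f : Pt d n → ℂ) : Prop where
  cd : ContDiff ℝ m f
  per : PerG f
  van : ∃ R : ℝ, ∀ z : Pt d n, R < ‖z.1‖ → f z = 0

lemma per_add {d n : ℕ} {X : Type*} {f : Pt d n → X} (h : PerG f) (w : Pt d n) :
    PerG (fun z => f (z + w)) := by
  intro j p
  simp only
  rw [← h j (p + w)]
  congr 1
  ext <;> simp; ring

lemma per_comp {d n : ℕ} {X Y : Type*} {f : Pt d n → X} (h : PerG f) (g : X → Y) :
    PerG (fun z => g (f z)) := by
  intro j p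
  simp only
  rw [h j p]

lemma per_comp2 {d n : ℕ} {X X' Y : Type*} {f : Pt d n → X} (h : PerG f)
    {f' : Pt d n → X'} (h' : PerG f') (g : X → X' → Y) :
    PerG (fun z => g (f z) (f' z)) := by
  intro j p
  simp only
  rw [h j p, h' j p]

lemma D_shift {d n : ℕ} (f : Pt d n → ℂ) (v w z : Pt d n) :
    D w (fun z => f (z + v)) z = D w f (z + v) := by
  simp only [D]
  rw [fderiv_comp_add_right]

lemma per_D {d n : ℕ} {f : Pt d n → ℂ} (h : PerG f) (w : Pt d n) : PerG (D w f) := by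
  intro j p
  have h1 : (fun z : Pt d n => f (z + (0, (2*π) • (Pi.single j 1 : Fin n → ℝ)))) = f := by
    funext z
    rw [← h j z]; congr 1; ext <;> simp
  have := D_shift f (0, (2*π) • (Pi.single j 1 : Fin n → ℝ)) w p
  rw [h1] at this
  rw [this]
  congr 1; ext <;> simp

lemma van_D {d n : ℕ} {f : Pt d n → ℂ} {R : ℝ} (h : ∀ z : Pt d n, R < ‖z.1‖ → f z = 0)
    (w : Pt d n) : ∀ z : Pt d n, R < ‖z.1‖ → D w f z = 0 := by
  intro z hz
  have ho : IsOpen {z : Pt d n | R < ‖z.1‖} := isOpen_lt continuous_const (by fun_prop)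
  have : f =ᶠ[nhds z] fun _ => 0 := by
    filter_upwards [ho.mem_nhds hz] with y hy using h y hy
  simp only [D]
  rw [this.fderiv_eq]; simp

lemma cd_D {d n : ℕ} {f : Pt d n → ℂ} {m : ℕ} (h : ContDiff ℝ (m+1 : ℕ) f) (w : Pt d n) :
    ContDiff ℝ m (D w f) := by
  have : ContDiff ℝ m (fderiv ℝ f) := h.fderiv_right (by norm_cast)
  exact this.clm_apply contDiff_const

lemma Nice.D {d n : ℕ} {f : Pt d n → ℂ} {m : ℕ} (h : Nice (m+1) f) (w : Pt d n) :
    Nice m (D w f) where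
  cd := cd_D h.cd w
  per := per_D h.per w
  van := by
    obtain ⟨R, hR⟩ := h.van
    exact ⟨R, van_D hR w⟩

lemma Nice.shift {d n : ℕ} {f : Pt d n → ℂ} {m : ℕ} (h : Nice m f) (w : Pt d n) :
    Nice m (fun z => f (z + w)) where
  cd := h.cd.comp (by fun_prop)
  per := per_add h.per w
  van := by
    obtain ⟨R, hR⟩ := h.van
    refine ⟨R + ‖w.1‖, fun z hz => hR _ ?_⟩
    have : ‖z.1‖ ≤ ‖(z+w).1‖ + ‖w.1‖ := by
      simpa using norm_sub_le (z.1 + w.1) w.1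
    linarith

lemma Nice.mono {d n : ℕ} {f : Pt d n → ℂ} {m k : ℕ} (h : Nice m f) (hk : k ≤ m) : Nice k f :=
  ⟨h.cd.of_le (by exact_mod_cast hk), h.per, h.van⟩

lemma Nice.mul {d n : ℕ} {f g : Pt d n → ℂ} {m : ℕ} (h : Nice m f) (h' : Nice m g) :
    Nice m (fun z => f z * g z) where
  cd := h.cd.mul h'.cd
  per := per_comp2 h.per h'.per _
  van := by
    obtain ⟨R, hR⟩ := h.van
    exact ⟨R, fun z hz => by simp [hR z hz]⟩

lemma Nice.sub {d n : ℕ} {f g : Pt d n → ℂ} {m : ℕ} (h : Nice m f) (h' : Nice m g) :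
    Nice m (fun z => f z - g z) where
  cd := h.cd.sub h'.cd
  per := per_comp2 h.per h'.per _
  van := by
    obtain ⟨R, hR⟩ := h.van
    obtain ⟨R', hR'⟩ := h'.van
    exact ⟨max R R', fun z hz => by simp [hR z ((le_max_left _ _).trans_lt hz), hR' z ((le_max_right _ _).trans_lt hz)]⟩

lemma Nice.conj {d n : ℕ} {f : Pt d n → ℂ} {m : ℕ} (h : Nice m f) :
    Nice m (fun z => (starRingEnd ℂ) (f z)) where
  cd := Complex.conjCLE.contDiff.comp h.cd
  per := per_comp h.per _
  van := by
    obtain ⟨R, hR⟩ := h.van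
    exact ⟨R, fun z hz => by simp [hR z hz]⟩

lemma D_conj {d n : ℕ} {f : Pt d n → ℂ} (h : ContDiff ℝ 1 f) (w z : Pt d n) :
    D w (fun z => (starRingEnd ℂ) (f z)) z = (starRingEnd ℂ) (D w f z) := by
  have h1 : HasFDerivAt f (fderiv ℝ f z) z := (h.differentiable (by norm_num) z).hasFDerivAt
  have := (Complex.conjCLE.toContinuousLinearMap.hasFDerivAt).comp z h1
  have h2 := this.fderiv
  simp only [D]
  erw [h2]
  rfl

lemma μP_eq (d n : ℕ) : μP d n = (volume : Measure (Pt d n)).restrict (univ ×ˢ torusBox n) := by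
  rw [μP, μT, Measure.volume_eq_prod, ← Measure.prod_restrict, Measure.restrict_univ]

lemma torusBox_meas (n : ℕ) : MeasurableSet (torusBox n) :=
  MeasurableSet.univ_pi fun _ => measurableSet_Ico

/-- compact set containing the support in one period -/
def Kc (d n : ℕ) (R : ℝ) : Set (Pt d n) :=
  Metric.closedBall 0 R ×ˢ (Set.univ.pi fun _ => Set.Icc 0 (2*π))

lemma Kc_compact (d n : ℕ) (R : ℝ) : IsCompact (Kc d n R) :=
  (isCompact_closedBall _ _).prod (isCompact_univ_pi fun _ => isCompact_Icc)

lemma integrable_of_van {d n : ℕ} {X : Type*} [NormedAddCommGroup X] {f : Pt d n → X}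
    (hf : Continuous f) {R : ℝ} (h : ∀ z : Pt d n, R < ‖z.1‖ → f z = 0) :
    Integrable f (μP d n) := by
  rw [μP_eq]
  have h1 : IntegrableOn f (Kc d n R) volume := hf.continuousOn.integrableOn_compact (Kc_compact d n R)
  refine IntegrableOn.of_forall_sdiff_eq_zero h1 (MeasurableSet.univ.prod (torusBox_meas n)) ?_
  rintro z ⟨hz, hz'⟩
  apply h
  by_contra hc
  apply hz'
  refine ⟨by simpa using not_lt.1 hc, fun j _ => ?_⟩
  have := hz.2 j (mem_univ j)
  exact ⟨this.1, this.2.le⟩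

lemma Nice.cont {d n : ℕ} {f : Pt d n → ℂ} {m : ℕ} (h : Nice m f) : Continuous f := h.cd.continuous

lemma Nice.integrable {d n : ℕ} {f : Pt d n → ℂ} {m : ℕ} (h : Nice m f) : Integrable f (μP d n) := by
  obtain ⟨R, hR⟩ := h.van
  exact integrable_of_van h.cont hR

lemma Nice.integrable_sq {d n : ℕ} {f : Pt d n → ℂ} {m : ℕ} (h : Nice m f) :
    Integrable (fun z => ‖f z‖^2) (μP d n) := by
  obtain ⟨R, hR⟩ := h.van
  exact integrable_of_van (R := R) (by have := h.cont; fun_prop) (fun z hz => by simp [hR z hz])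

lemma Nice.bdd {d n : ℕ} {f : Pt d n → ℂ} {m : ℕ} (h : Nice m f) : ∃ C : ℝ, ∀ z, ‖f z‖ ≤ C := by
  obtain ⟨R, hR⟩ := h.van
  obtain ⟨C, hC⟩ := (Kc_compact d n R).exists_bound_of_continuousOn h.cont.continuousOn
  refine ⟨max C 0, fun z => ?_⟩
  have h1 : f z = f (phi 0 z) := by rw [h.per.phi]; simp
  by_cases hz : R < ‖z.1‖
  · rw [hR z hz]; simp
  · rw [h1]
    refine (hC _ ?_).trans (le_max_left _ _)
    refine ⟨by simpa [phi] using hz, fun j _ => ?_⟩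
    have := toIocMod_mem_Ioc (p := 2*π) (by positivity) 0 (z.2 j + 0)
    simp only [phi, psi]
    exact ⟨this.1.le, by simpa using this.2⟩

lemma hasDerivAt_line {d n : ℕ} {f : Pt d n → ℂ} (h : ContDiff ℝ 1 f) (z w : Pt d n) (t : ℝ) :
    HasDerivAt (fun t : ℝ => f (z + t • w)) (D w f (z + t • w)) t := by
  have h1 : HasFDerivAt f (fderiv ℝ f (z + t • w)) (z + t • w) :=
    (h.differentiable (by norm_num) _).hasFDerivAt
  have h2 : HasDerivAt (fun t : ℝ => z + t • w) w t := by
    simpa using ((hasDerivAt_id t).smul_const w).const_add z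
  exact h1.comp_hasDerivAt t h2

/-- differentiate a correlation -/
lemma corr_deriv {d n : ℕ} {f g : Pt d n → ℂ} (hf : Nice 1 f) (hg : Nice 0 g) (w : Pt d n) :
    HasDerivAt (fun t : ℝ => ∫ z, f (z + t • w) * g z ∂(μP d n)) (∫ z, D w f z * g z ∂(μP d n)) 0 := by
  obtain ⟨C, hC⟩ := (hf.D w).bdd
  have := (hasDerivAt_integral_of_dominated_loc_of_deriv_le (μ := μP d n) (𝕜 := ℝ) (x₀ := 0)
    (s := univ) (F := fun t z => f (z + t • w) * g z) (F' := fun t z => D w f (z + t • w) * g z)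
    (bound := fun z => C * ‖g z‖) Filter.univ_mem ?_ ?_ ?_ ?_ ?_ ?_).2
  · simpa using this
  · filter_upwards with t
    exact (((hf.shift (t • w)).mono (Nat.zero_le _)).mul hg).integrable.1
  · exact (((hf.shift ((0:ℝ) • w)).mono (Nat.zero_le _)).mul hg).integrable
  · exact (((hf.D w).shift ((0:ℝ) • w)).mul hg).integrable.1
  · filter_upwards with z t _
    rw [norm_mul]
    exact mul_le_mul_of_nonneg_right (hC _) (norm_nonneg _)
  · exact hg.integrable.norm.const_mul C
  · filter_upwards with z t _
    exact (hasDerivAt_line hf.cd z w t).mul_const _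

lemma ibp {d n : ℕ} {f g : Pt d n → ℂ} (hf : Nice 1 f) (hg : Nice 1 g) (w : Pt d n) :
    ∫ z, D w f z * g z ∂(μP d n) = - ∫ z, f z * D w g z ∂(μP d n) := by
  have h1 := corr_deriv hf (hg.mono (Nat.zero_le _)) w
  have h2 := corr_deriv hg (hf.mono (Nat.zero_le _)) (-w)
  have h3 : (fun t : ℝ => ∫ z, f (z + t • w) * g z ∂(μP d n)) =
      (fun t : ℝ => ∫ z, g (z + t • (-w)) * f z ∂(μP d n)) := by
    funext t
    have hn := ((hg.shift (t • (-w))).mul hf)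
    rw [← hn.per.integral_add hn.cont.stronglyMeasurable (t • w)]
    congr 1; funext z
    rw [mul_comm]; congr 2; simp
  rw [h3] at h1
  rw [h1.unique h2, ← integral_neg]
  congr 1; funext z
  simp [D]; ring


lemma D_D {d n : ℕ} {f : Pt d n → ℂ} (h : ContDiff ℝ 2 f) (v w z : Pt d n) :
    D v (D w f) z = fderiv ℝ (fderiv ℝ f) z v w := by
  have hd : DifferentiableAt ℝ (fderiv ℝ f) z :=
    (h.fderiv_right (m := 1) (by norm_num)).differentiable (by norm_num) z
  have := hd.hasFDerivAt.clm_apply (hasFDerivAt_const w z)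
  change fderiv ℝ (fun y => fderiv ℝ f y w) z v = _
  rw [this.fderiv]; simp

lemma D_symm {d n : ℕ} {f : Pt d n → ℂ} (h : ContDiff ℝ 2 f) (v w z : Pt d n) :
    D v (D w f) z = D w (D v f) z := by
  have := (h.contDiffAt (x := z)).isSymmSndFDerivAt (by simp)
  rw [D_D h, D_D h]; exact this v w

lemma hess_ibp {d n : ℕ} {f : Pt d n → ℂ} (h : Nice 2 f) (v w : Pt d n) :
    ∫ z, D v (D v f) z * (starRingEnd ℂ) (D w (D w f) z) ∂(μP d n)
      = ∫ z, D v (D w f) z * (starRingEnd ℂ) (D v (D w f) z) ∂(μP d n) := by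
  have hv := h.D v
  have hw := h.D w
  have h1 := corr_deriv hv (hw.D w).conj v
  have h2 := corr_deriv hw (hw.D v).conj v
  have h3 : (fun t : ℝ => ∫ z, D v f (z + t • v) * (starRingEnd ℂ) (D w (D w f) z) ∂(μP d n)) =
      (fun t : ℝ => ∫ z, D w f (z + t • v) * (starRingEnd ℂ) (D v (D w f) z) ∂(μP d n)) := by
    funext t
    have e1 := ibp (hv.shift (t • v)) hw.conj w
    have e2 := ibp (hw.shift (t • v)) hw.conj v
    simp only [D_conj hw.cd, D_shift] at e1 e2
    simp only [D_symm h.cd w v] at e1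
    rw [e1] at e2
    exact neg_injective e2
  rw [h3] at h1
  exact h1.unique h2

lemma integral_mul_conj {d n : ℕ} (f : Pt d n → ℂ) :
    (∫ z, f z * (starRingEnd ℂ) (f z) ∂(μP d n)) = ((∫ z, ‖f z‖^2 ∂(μP d n) : ℝ) : ℂ) := by
  rw [← integral_complex_ofReal]
  congr 1; funext z
  rw [Complex.mul_conj, Complex.normSq_eq_norm_sq]

lemma Nice.sum {d n : ℕ} {ι : Type*} (s : Finset ι) {f : ι → Pt d n → ℂ} {m : ℕ}
    (h : ∀ i, Nice m (f i)) : Nice m (fun z => ∑ i ∈ s, f i z) where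
  cd := ContDiff.sum fun i _ => (h i).cd
  per := by
    intro j p
    exact Finset.sum_congr rfl fun i _ => (h i).per j p
  van := by
    choose R hR using fun i => (h i).van
    refine ⟨∑ i ∈ s, |R i|, fun z hz => Finset.sum_eq_zero fun i hi => hR i z ?_⟩
    exact ((le_abs_self _).trans (Finset.single_le_sum (f := fun i => |R i|)
      (fun _ _ => abs_nonneg _) hi)).trans_lt hz

lemma Nice.lap {d n : ℕ} {f : Pt d n → ℂ} (h : Nice 2 f) : Nice 0 (lap d n f) := by
  have : BNLS.lap d n f = fun z => ∑ k, BNLS.D (ee k) (BNLS.D (ee k) f) z := by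
    funext z; exact lap_eq f z
  rw [this]
  exact Nice.sum _ fun k => (h.D _).D _

/-- the Laplacian controls the Hessian -/
lemma lapSq_eq {d n : ℕ} {f : Pt d n → ℂ} (h : Nice 2 f) :
    lapSq d n f = ∑ k, ∑ l, ∫ z, ‖D (ee k) (D (ee l) f) z‖^2 ∂(μP d n) := by
  have h1 : ((lapSq d n f : ℝ) : ℂ) =
      ((∑ k, ∑ l, ∫ z, ‖D (ee k) (D (ee l) f) z‖^2 ∂(μP d n) : ℝ) : ℂ) := by
    rw [lapSq, ← integral_mul_conj]
    simp only [lap_eq, map_sum, Finset.sum_mul_sum]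
    rw [integral_finsetSum]
    · push_cast
      refine Finset.sum_congr rfl fun k _ => ?_
      rw [integral_finsetSum]
      · refine Finset.sum_congr rfl fun l _ => ?_
        rw [hess_ibp h, integral_mul_conj]
      · intro l _
        exact (((h.D _).D _).mul ((h.D _).D _).conj).integrable
    · intro k _
      refine integrable_finsetSum _ fun l _ => ?_
      exact (((h.D _).D _).mul ((h.D _).D _).conj).integrable
  exact_mod_cast h1

lemma gradSq_eq {d n : ℕ} {f : Pt d n → ℂ} (h : Nice 1 f) :
    gradSq d n f = ∑ k, ∫ z, ‖D (ee k) f z‖^2 ∂(μP d n) := by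
  rw [gradSq, gradXSq, gradYSq, Fintype.sum_sum_type, integral_finsetSum, integral_finsetSum]
  · rfl
  · intro j _
    exact (h.D (ee (Sum.inr j))).integrable_sq
  · intro j _
    exact (h.D (ee (Sum.inl j))).integrable_sq

lemma grad_le {d n : ℕ} {f : Pt d n → ℂ} (h : Nice 2 f) {δ : ℝ} (hδ : 0 < δ) :
    gradSq d n f ≤ δ * lapSq d n f + 1 / (4 * δ) * Mass d n f := by
  have h1 : ((gradSq d n f : ℝ) : ℂ) = - ∫ z, lap d n f z * (starRingEnd ℂ) (f z) ∂(μP d n) := by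
    rw [gradSq_eq (h.mono (by norm_num))]
    simp only [lap_eq, Finset.sum_mul]
    rw [integral_finsetSum, ← Finset.sum_neg_distrib]
    · push_cast
      refine Finset.sum_congr rfl fun k _ => ?_
      have h1 : Nice 1 f := h.mono (by norm_num)
      have := ibp (h.D (ee k)) h1.conj (ee k)
      rw [this, neg_neg]
      simp only [D_conj h1.cd]
      rw [integral_mul_conj]
    · intro k _
      exact (((h.D _).D _).mul (h.mono (Nat.zero_le _)).conj).integrable
  have h2 : gradSq d n f ≤ ‖∫ z, lap d n f z * (starRingEnd ℂ) (f z) ∂(μP d n)‖ := by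
    rw [← norm_neg, ← h1]
    simpa using le_abs_self _
  refine h2.trans ((norm_integral_le_integral_norm _).trans ?_)
  rw [lapSq, Mass, ← integral_const_mul, ← integral_const_mul, ← integral_add]
  · refine integral_mono (h.lap.mul (h.mono (Nat.zero_le _)).conj).integrable.norm
      ((h.lap.integrable_sq.const_mul _).add (h.integrable_sq.const_mul _)) fun z => ?_
    simp only [norm_mul, RCLike.norm_conj]
    have : 0 ≤ (2 * δ * ‖lap d n f z‖ - ‖f z‖)^2 / (4 * δ) := by positivity
    have e : (2 * δ * ‖lap d n f z‖ - ‖f z‖)^2 / (4 * δ) =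
      δ * ‖lap d n f z‖^2 + 1 / (4 * δ) * ‖f z‖^2 - ‖lap d n f z‖ * ‖f z‖ := by
      field_simp; ring
    linarith
  · exact h.lap.integrable_sq.const_mul _
  · exact h.integrable_sq.const_mul _

/-- difference bound in L2 -/
lemma diff_le {d n : ℕ} {f : Pt d n → ℂ} (h : Nice 1 f) (w : Pt d n) :
    ∫ z, ‖f (z + w) - f z‖^2 ∂(μP d n) ≤ ∫ z, ‖D w f z‖^2 ∂(μP d n) := by
  have hN := (h.shift w).sub h
  have hc := h.cont
  have hcD := (h.D w).cont
  have key : ∀ z, ENNReal.ofReal (‖f (z + w) - f z‖^2) ≤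
      ∫⁻ t in Ioc (0:ℝ) 1, ENNReal.ofReal (‖D w f (z + t • w)‖^2) := by
    intro z
    have hcont : Continuous fun t : ℝ => D w f (z + t • w) := by fun_prop
    have e1 : f (z + w) - f z = ∫ t in (0:ℝ)..1, D w f (z + t • w) := by
      rw [intervalIntegral.integral_eq_sub_of_hasDerivAt
        (fun t _ => hasDerivAt_line h.cd z w t) (hcont.intervalIntegrable _ _)]
      simp
    have e2 : ‖f (z + w) - f z‖ ≤ ∫ t in (0:ℝ)..1, ‖D w f (z + t • w)‖ := by
      rw [e1]; exact intervalIntegral.norm_integral_le_integral_norm (by norm_num)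
    have e3 : ‖f (z + w) - f z‖^2 ≤ ∫ t in (0:ℝ)..1, ‖D w f (z + t • w)‖^2 := by
      set a := ‖f (z + w) - f z‖
      have : 0 ≤ ∫ t in (0:ℝ)..1, (‖D w f (z + t • w)‖ - a)^2 :=
        intervalIntegral.integral_nonneg (by norm_num) fun t _ => sq_nonneg _
      have e4 : ∫ t in (0:ℝ)..1, (‖D w f (z + t • w)‖ - a)^2 =
        (∫ t in (0:ℝ)..1, ‖D w f (z + t • w)‖^2) - 2 * a * (∫ t in (0:ℝ)..1, ‖D w f (z + t • w)‖)
          + a^2 := by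
        have : ∀ t : ℝ, (‖D w f (z + t • w)‖ - a)^2 =
          ‖D w f (z + t • w)‖^2 - 2 * a * ‖D w f (z + t • w)‖ + a^2 := by intro t; ring
        simp_rw [this]
        rw [intervalIntegral.integral_add, intervalIntegral.integral_sub,
          intervalIntegral.integral_const_mul]
        · simp
        all_goals
          apply Continuous.intervalIntegrable
          fun_prop
      have ha : 0 ≤ a := norm_nonneg _
      nlinarith
    rw [← ofReal_integral_eq_lintegral_ofReal, ← intervalIntegral.integral_of_le (by norm_num)]
    · exact ENNReal.ofReal_le_ofReal e3
    · exact (Continuous.intervalIntegrable (by fun_prop) 0 1 : IntervalIntegrable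
        (fun t : ℝ => ‖D w f (z + t • w)‖^2) volume 0 1).1
    · filter_upwards with t
      positivity
  have hb : ENNReal.ofReal (∫ z, ‖f (z + w) - f z‖^2 ∂(μP d n)) ≤
      ENNReal.ofReal (∫ z, ‖D w f z‖^2 ∂(μP d n)) := by
    rw [ofReal_integral_eq_lintegral_ofReal hN.integrable_sq (by filter_upwards with t; positivity),
      ofReal_integral_eq_lintegral_ofReal (h.D w).integrable_sq (by filter_upwards with t; positivity)]
    refine (lintegral_mono key).trans ?_
    have : SFinite (μP d n) := by unfold μP; infer_instance
    rw [lintegral_lintegral_swap (by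
      apply Measurable.aemeasurable
      apply Measurable.ennreal_ofReal
      apply Continuous.measurable
      change Continuous fun p : Pt d n × ℝ => ‖D w f (p.1 + p.2 • w)‖^2
      fun_prop)]
    have : ∀ t : ℝ, ∫⁻ z, ENNReal.ofReal (‖D w f (z + t • w)‖^2) ∂(μP d n) =
        ∫⁻ z, ENNReal.ofReal (‖D w f z‖^2) ∂(μP d n) := by
      intro t
      have hp : PerG (fun z => ENNReal.ofReal (‖D w f z‖^2)) :=
        per_comp (h.D w).per (fun c => ENNReal.ofReal (‖c‖^2))
      exact hp.lintegral_add (by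
        apply Measurable.ennreal_ofReal
        apply Continuous.measurable
        fun_prop) (t • w)
    simp_rw [this]
    simp
  exact (ENNReal.ofReal_le_ofReal_iff (integral_nonneg fun z => by positivity)).1 hb


lemma ee_sum {d n : ℕ} (w : Pt d n) : w = ∑ k, (Sum.elim w.1 w.2 k : ℝ) • (ee k : Pt d n) := by
  rw [Fintype.sum_sum_type]
  ext i
  · simp [ee, Prod.fst_sum, Finset.sum_apply, Pi.single_apply]
  · simp [ee, Prod.snd_sum, Finset.sum_apply, Pi.single_apply]

lemma coord_le {d n : ℕ} (w : Pt d n) (k : Fin d ⊕ Fin n) : |(Sum.elim w.1 w.2 k : ℝ)| ≤ ‖w‖ := by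
  rcases k with i | j
  · exact (norm_le_pi_norm w.1 i).trans (norm_fst_le w)
  · exact (norm_le_pi_norm w.2 j).trans (norm_snd_le w)

lemma DD_le {d n : ℕ} {f : Pt d n → ℂ} (h : ContDiff ℝ 2 f) (w z : Pt d n) :
    ‖D w (D w f) z‖^2 ≤ ‖w‖^4 * ((d + n : ℕ) : ℝ)^2 * ∑ k, ∑ l, ‖D (ee k) (D (ee l) f) z‖^2 := by
  have h1 : D w (D w f) z = ∑ p : (Fin d ⊕ Fin n) × (Fin d ⊕ Fin n),
      ((Sum.elim w.1 w.2 p.1 : ℝ) * (Sum.elim w.1 w.2 p.2 : ℝ)) • D (ee p.1) (D (ee p.2) f) z := by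
    rw [Fintype.sum_prod_type]
    simp only [D_D h]
    conv_lhs => rw [ee_sum w]
    simp only [map_sum, map_smul, _root_.sum_apply, _root_.smul_apply,
      Finset.smul_sum, smul_smul]
    rw [Finset.sum_comm]
    refine Finset.sum_congr rfl fun k _ => Finset.sum_congr rfl fun l _ => ?_
    rw [mul_comm]
  have h2 : ‖D w (D w f) z‖ ≤ ‖w‖^2 * ∑ p : (Fin d ⊕ Fin n) × (Fin d ⊕ Fin n),
      ‖D (ee p.1) (D (ee p.2) f) z‖ := by
    rw [h1, Finset.mul_sum]
    refine (norm_sum_le _ _).trans (Finset.sum_le_sum fun p _ => ?_)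
    rw [norm_smul, norm_mul, pow_two]
    gcongr
    · exact coord_le w p.1
    · exact coord_le w p.2
  have h3 := sq_sum_le_card_mul_sum_sq (s := (Finset.univ : Finset ((Fin d ⊕ Fin n) × (Fin d ⊕ Fin n))))
    (f := fun p => ‖D (ee p.1) (D (ee p.2) f) z‖)
  rw [Fintype.sum_prod_type (f := fun p : (Fin d ⊕ Fin n) × (Fin d ⊕ Fin n) =>
    ‖D (ee p.1) (D (ee p.2) f) z‖^2)] at h3
  have h4 : ((Finset.univ : Finset ((Fin d ⊕ Fin n) × (Fin d ⊕ Fin n))).card : ℝ) =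
      ((d + n : ℕ) : ℝ)^2 := by
    simp [pow_two]
  rw [h4] at h3
  calc ‖D w (D w f) z‖^2 ≤ (‖w‖^2 * ∑ p : (Fin d ⊕ Fin n) × (Fin d ⊕ Fin n),
      ‖D (ee p.1) (D (ee p.2) f) z‖)^2 := by gcongr
    _ = ‖w‖^4 * (∑ p : (Fin d ⊕ Fin n) × (Fin d ⊕ Fin n), ‖D (ee p.1) (D (ee p.2) f) z‖)^2 := by ring
    _ ≤ ‖w‖^4 * (((d + n : ℕ) : ℝ)^2 * ∑ k, ∑ l, ‖D (ee k) (D (ee l) f) z‖^2) := by gcongr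
    _ = _ := by ring

lemma DDint_le {d n : ℕ} {f : Pt d n → ℂ} (h : Nice 2 f) (w : Pt d n) :
    ∫ z, ‖D w (D w f) z‖^2 ∂(μP d n) ≤ ‖w‖^4 * ((d + n : ℕ) : ℝ)^2 * lapSq d n f := by
  have hi : ∀ k l, Integrable (fun z => ‖D (ee k) (D (ee l) f) z‖^2) (μP d n) :=
    fun k l => ((h.D _).D _).integrable_sq
  rw [lapSq_eq h]
  simp_rw [← integral_finsetSum _ (fun l _ => hi _ l)]
  rw [← integral_finsetSum _ (fun k _ => integrable_finsetSum _ fun l _ => hi k l),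
    ← integral_const_mul]
  exact integral_mono ((h.D w).D w).integrable_sq
    ((integrable_finsetSum _ fun k _ => integrable_finsetSum _ fun l _ => hi k l).const_mul _)
    fun z => DD_le h.cd w z

/-- second difference -/
def S2 {d n : ℕ} (f : Pt d n → ℂ) (w z : Pt d n) : ℂ := (f (z + w) - f z) - (f (z + -w + w) - f (z + -w))

lemma S2_nice {d n : ℕ} {f : Pt d n → ℂ} {m : ℕ} (h : Nice m f) (w : Pt d n) : Nice m (S2 f w) :=
  ((h.shift w).sub h).sub (((h.shift w).sub h).shift (-w))

lemma D_sub' {d n : ℕ} {f g : Pt d n → ℂ} (h : ContDiff ℝ 1 f) (h' : ContDiff ℝ 1 g) (w z : Pt d n) :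
    D w (fun z => f z - g z) z = D w f z - D w g z := by
  simp only [D]
  rw [fderiv_fun_sub (h.differentiable (by norm_num) z) (h'.differentiable (by norm_num) z)]
  rfl

lemma S2_le {d n : ℕ} {f : Pt d n → ℂ} (h : Nice 2 f) (w : Pt d n) :
    ∫ z, ‖S2 f w z‖^2 ∂(μP d n) ≤ ‖w‖^4 * ((d + n : ℕ) : ℝ)^2 * lapSq d n f := by
  refine le_trans ?_ (DDint_le h w)
  have h1 : Nice 1 f := h.mono (by norm_num)
  have hg := (h1.shift w).sub h1
  have e1 := diff_le hg (-w)
  have e2 := diff_le (h.D w) w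
  have e3 : ∀ z, ‖D (-w) (fun z => f (z + w) - f z) z‖^2 = ‖D w f (z + w) - D w f z‖^2 := by
    intro z
    rw [← D_shift f w w z, ← D_sub' (h1.shift w).cd h1.cd]
    simp [D]
  simp_rw [e3] at e1
  refine le_trans (le_of_eq ?_) (e1.trans e2)
  congr 1; funext z
  rw [← norm_neg]; simp [S2]

lemma cs {X : Type*} [MeasurableSpace X] (ν : Measure X) [IsFiniteMeasure ν] (hν : 0 < ν.real univ)
    {F : X → ℂ} (h1 : Integrable F ν) (h2 : Integrable (fun x => ‖F x‖^2) ν) :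
    ‖∫ x, F x ∂ν‖^2 ≤ ν.real univ * ∫ x, ‖F x‖^2 ∂ν := by
  set V := ν.real univ
  set I := ∫ x, ‖F x‖ ∂ν
  have hI : ‖∫ x, F x ∂ν‖ ≤ I := norm_integral_le_integral_norm _
  have h0 : 0 ≤ ∫ x, (‖F x‖ - I / V)^2 ∂ν := integral_nonneg fun _ => sq_nonneg _
  have e : ∫ x, (‖F x‖ - I / V)^2 ∂ν = (∫ x, ‖F x‖^2 ∂ν) - 2 * (I / V) * I + V * (I/V)^2 := by
    have : ∀ x, (‖F x‖ - I / V)^2 = ‖F x‖^2 - 2 * (I / V) * ‖F x‖ + (I/V)^2 := by intro t; ring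
    simp_rw [this]
    have i1 : Integrable (fun x => ‖F x‖^2 - 2 * (I / V) * ‖F x‖) ν := h2.sub (h1.norm.const_mul _)
    rw [integral_add i1 (integrable_const _),
      integral_sub h2 (h1.norm.const_mul _), integral_const_mul, integral_const]
    rfl
  rw [e] at h0
  have e2 : V * ((∫ x, ‖F x‖^2 ∂ν) - 2 * (I / V) * I + V * (I/V)^2) = V * (∫ x, ‖F x‖^2 ∂ν) - I^2 := by
    field_simp; ring
  have := mul_nonneg hν.le h0
  rw [e2] at this
  have : ‖∫ x, F x ∂ν‖^2 ≤ I^2 := by gcongr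
  linarith

instance haar_inst (d n : ℕ) : (volume : Measure (Pt d n)).IsAddHaarMeasure :=
  Measure.prod.instIsAddHaarMeasure (volume : Measure (Fin d → ℝ)) (volume : Measure (Fin n → ℝ))

instance neg_inst (d n : ℕ) : (volume : Measure (Pt d n)).IsNegInvariant :=
  Measure.IsAddHaarMeasure.isNegInvariant_of_regular _

/-- ball of averaging -/
abbrev BB (d n : ℕ) (r : ℝ) : Set (Pt d n) := Metric.closedBall 0 r

lemma box_le {d n : ℕ} {f : Pt d n → ℂ} (h : Nice 0 f) {r : ℝ} (hr : r ≤ 3) (z : Pt d n) :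
    ∫ w in BB d n r, ‖f (z + w)‖^2 ≤ Mass d n f := by
  set p : Pt d n := (0, fun _ => π)
  have hB' : MeasurableSet ((fun w : Pt d n => w - p) ⁻¹' BB d n r) :=
    (measurable_id.sub_const p) Metric.isClosed_closedBall.measurableSet
  have e1 : ∫ w in BB d n r, ‖f (z + w)‖^2 =
      ∫ w in (fun w : Pt d n => w - p) ⁻¹' BB d n r, ‖f (w + (z - p))‖^2 := by
    rw [← integral_indicator Metric.isClosed_closedBall.measurableSet, ← integral_indicator hB',
      ← integral_sub_right_eq_self _ p]
    congr 1; funext w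
    by_cases hw : w - p ∈ BB d n r
    · rw [indicator_of_mem hw, indicator_of_mem (by exact hw)]
      congr 3; abel
    · rw [indicator_of_notMem hw, indicator_of_notMem (by exact hw)]
  have hn := h.shift (z - p)
  have e2 : Mass d n f = ∫ w in univ ×ˢ torusBox n, ‖f (w + (z - p))‖^2 := by
    have hp : PerG (fun z => ‖f z‖^2) := per_comp h.per (fun c => ‖c‖^2)
    have := hp.integral_add (by
      apply Continuous.stronglyMeasurable
      have := h.cont
      fun_prop) (z - p)
    rw [Mass, ← this, μP_eq]
  rw [e1, e2]
  refine setIntegral_mono_set ?_ ?_ ?_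
  · have := hn.integrable_sq
    rwa [μP_eq] at this
  · filter_upwards with w
    positivity
  · refine LE.le.eventuallyLE ?_
    intro w hw
    refine ⟨mem_univ _, fun j _ => ?_⟩
    have h1 : ‖w - p‖ ≤ r := by simpa using hw
    have h2 : |w.2 j - π| ≤ 3 := ((norm_le_pi_norm (w - p).2 j).trans (norm_snd_le (w - p))).trans (h1.trans hr)
    have := Real.pi_gt_three
    rw [abs_le] at h2
    constructor <;> linarith

lemma BB_refl {d n : ℕ} (F : Pt d n → ℂ) (r : ℝ) :
    ∫ w in BB d n r, F (-w) = ∫ w in BB d n r, F w := by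
  rw [← integral_indicator Metric.isClosed_closedBall.measurableSet,
    ← integral_indicator Metric.isClosed_closedBall.measurableSet,
    ← integral_neg_eq_self ((BB d n r).indicator fun x => F x)]
  congr 1; funext w
  by_cases hw : w ∈ BB d n r
  · rw [indicator_of_mem hw, indicator_of_mem (by simpa using hw)]
  · rw [indicator_of_notMem hw, indicator_of_notMem (by simpa using hw)]

lemma BB_fin {d n : ℕ} (r : ℝ) : IsFiniteMeasure ((volume : Measure (Pt d n)).restrict (BB d n r)) :=
  ⟨by simpa using (isCompact_closedBall (0 : Pt d n) r).measure_lt_top⟩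

/-- key pointwise estimate -/
lemma ptw {d n : ℕ} {f : Pt d n → ℂ} (h : Nice 0 f) {r t : ℝ} (hr : 0 < r) (hr3 : r ≤ 3)
    (ht : 0 < t) (hV : 4 * Mass d n f ≤ t^2 * volume.real (BB d n r)) (z : Pt d n) (hz : t < ‖f z‖) :
    ‖f z‖^2 ≤ (volume.real (BB d n r))⁻¹ * ∫ w in BB d n r, ‖S2 f w z‖^2 := by
  set V := volume.real (BB d n r) with hVdef
  have hfin := BB_fin (d := d) (n := n) r
  have hVpos : 0 < V := by
    rw [hVdef, Measure.real, ENNReal.toReal_pos_iff]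
    exact ⟨Metric.measure_closedBall_pos _ _ hr, (isCompact_closedBall (0 : Pt d n) r).measure_lt_top⟩
  have hV1 : ((volume : Measure (Pt d n)).restrict (BB d n r)).real univ = V := by
    simp [hVdef, Measure.real]
  have hc := h.cont
  have hcint : ∀ {X : Type} [NormedAddCommGroup X] (F : Pt d n → X), Continuous F →
      Integrable F ((volume : Measure (Pt d n)).restrict (BB d n r)) := by
    intro X _ F hF
    exact hF.continuousOn.integrableOn_compact (isCompact_closedBall (0 : Pt d n) r)
  set G := ∫ w in BB d n r, f (z + w) with hG
  have a1 : ‖G‖^2 ≤ V * Mass d n f := by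
    have := cs ((volume : Measure (Pt d n)).restrict (BB d n r)) (by rw [hV1]; exact hVpos)
      (F := fun w => f (z + w)) (hcint _ (by fun_prop)) (hcint _ (by fun_prop))
    rw [hV1] at this
    exact this.trans (mul_le_mul_of_nonneg_left (box_le h hr3 z) hVpos.le)
  have a2 : ‖G‖ ≤ t * V / 2 := by
    apply le_of_sq_le_sq _ (by positivity)
    nlinarith
  have hcS : Continuous fun w => S2 f w z := by unfold S2; fun_prop
  have b1 : ∫ w in BB d n r, S2 f w z = 2 * G - 2 * V * f z := by
    have e : ∀ w, S2 f w z = f (z + w) + f (z + -w) - 2 * f z := by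
      intro w; simp [S2]; ring
    simp_rw [e]
    rw [integral_sub, integral_add, BB_refl (fun w => f (z + w)), integral_const, hV1]
    · simp; ring
    · exact hcint _ (by fun_prop)
    · exact hcint _ (by fun_prop)
    · exact hcint _ (by fun_prop)
    · exact hcint _ (by fun_prop)
  have b2 := cs ((volume : Measure (Pt d n)).restrict (BB d n r)) (by rw [hV1]; exact hVpos)
      (F := fun w => S2 f w z) (hcint _ hcS) (hcint _ (by fun_prop))
  rw [hV1, b1] at b2
  have b3 : V * ‖f z‖ ≤ ‖2 * G - 2 * V * f z‖ := by
    have : ‖(2 * V * f z : ℂ)‖ ≤ ‖2 * G - 2 * V * f z‖ + ‖2 * G‖ := by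
      rw [norm_sub_rev]
      simpa using norm_add_le (2 * V * f z - 2 * G) (2 * G)
    simp only [norm_mul, Complex.norm_real, Complex.norm_ofNat, Real.norm_eq_abs, abs_of_pos hVpos] at this
    nlinarith
  have b4 : (V * ‖f z‖)^2 ≤ V * ∫ w in BB d n r, ‖S2 f w z‖^2 := le_trans (by gcongr) b2
  rw [inv_mul_eq_div, le_div_iff₀ hVpos]
  have : V * (‖f z‖^2 * V) ≤ V * ∫ w in BB d n r, ‖S2 f w z‖^2 := by linarith [b4]
  exact le_of_mul_le_mul_left this hVpos

lemma tail_le {d n : ℕ} {f : Pt d n → ℂ} (h : Nice 2 f) {r t : ℝ} (hr : 0 < r) (hr3 : r ≤ 3)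
    (ht : 0 < t) (hV : 4 * Mass d n f ≤ t^2 * volume.real (BB d n r)) :
    ∫ z in {z | t < ‖f z‖}, ‖f z‖^2 ∂(μP d n) ≤ r^4 * ((d + n : ℕ) : ℝ)^2 * lapSq d n f := by
  have h0 : Nice 0 f := h.mono (Nat.zero_le _)
  have hc := h.cont
  have hfin := BB_fin (d := d) (n := n) r
  set V := volume.real (BB d n r) with hVdef
  have hVpos : 0 < V := by
    rw [hVdef, Measure.real, ENNReal.toReal_pos_iff]
    exact ⟨Metric.measure_closedBall_pos _ _ hr, (isCompact_closedBall (0 : Pt d n) r).measure_lt_top⟩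
  have hL : 0 ≤ lapSq d n f := integral_nonneg fun z => by positivity
  have hcS : Continuous fun q : Pt d n × Pt d n => S2 f q.2 q.1 := by unfold S2; fun_prop
  have hms : MeasurableSet {z | t < ‖f z‖} := (isOpen_lt continuous_const hc.norm).measurableSet
  have key : ENNReal.ofReal (∫ z in {z | t < ‖f z‖}, ‖f z‖^2 ∂(μP d n)) ≤
      ENNReal.ofReal (r^4 * ((d + n : ℕ) : ℝ)^2 * lapSq d n f) := by
    rw [ofReal_integral_eq_lintegral_ofReal h.integrable_sq.integrableOn (by filter_upwards with z; positivity)]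
    calc ∫⁻ z in {z | t < ‖f z‖}, ENNReal.ofReal (‖f z‖^2) ∂(μP d n)
        ≤ ∫⁻ z in {z | t < ‖f z‖}, ENNReal.ofReal (V⁻¹) *
            (∫⁻ w in BB d n r, ENNReal.ofReal (‖S2 f w z‖^2)) ∂(μP d n) := by
          refine setLIntegral_mono' hms fun z hz => ?_
          rw [← ofReal_integral_eq_lintegral_ofReal, ← ENNReal.ofReal_mul (by positivity)]
          · exact ENNReal.ofReal_le_ofReal (ptw h0 hr hr3 ht hV z hz)
          · have : Continuous fun w => ‖S2 f w z‖^2 := by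
              have := hcS.comp (Continuous.prodMk_right z)
              exact (this.norm).pow 2
            exact this.continuousOn.integrableOn_compact (isCompact_closedBall (0 : Pt d n) r)
          · filter_upwards with w; positivity
      _ ≤ ∫⁻ z, ENNReal.ofReal (V⁻¹) *
            (∫⁻ w in BB d n r, ENNReal.ofReal (‖S2 f w z‖^2)) ∂(μP d n) := setLIntegral_le_lintegral _ _
      _ = ENNReal.ofReal (V⁻¹) * ∫⁻ z, (∫⁻ w in BB d n r, ENNReal.ofReal (‖S2 f w z‖^2)) ∂(μP d n) := by
          rw [lintegral_const_mul' _ _ ENNReal.ofReal_ne_top]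
      _ = ENNReal.ofReal (V⁻¹) * ∫⁻ w in BB d n r, ∫⁻ z, ENNReal.ofReal (‖S2 f w z‖^2) ∂(μP d n) := by
          have : SFinite (μP d n) := by unfold μP; infer_instance
          rw [lintegral_lintegral_swap]
          apply Measurable.aemeasurable
          apply Measurable.ennreal_ofReal
          apply Continuous.measurable
          exact hcS.norm.pow 2
      _ ≤ ENNReal.ofReal (V⁻¹) * ∫⁻ w in BB d n r, ENNReal.ofReal (r^4 * ((d + n : ℕ) : ℝ)^2 * lapSq d n f) := by
          refine mul_le_mul_right ?_ _
          refine setLIntegral_mono' Metric.isClosed_closedBall.measurableSet fun w hw => ?_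
          rw [← ofReal_integral_eq_lintegral_ofReal (S2_nice h w).integrable_sq
            (by filter_upwards with z; positivity)]
          refine ENNReal.ofReal_le_ofReal ((S2_le h w).trans ?_)
          have : ‖w‖ ≤ r := by simpa using hw
          gcongr
      _ = ENNReal.ofReal (r^4 * ((d + n : ℕ) : ℝ)^2 * lapSq d n f) := by
          rw [setLIntegral_const]
          have : volume (BB d n r) = ENNReal.ofReal V := by
            rw [hVdef, Measure.real, ENNReal.ofReal_toReal]
            exact (isCompact_closedBall (0 : Pt d n) r).measure_lt_top.ne
          rw [this, mul_comm (ENNReal.ofReal (r^4 * _ * _)), ← mul_assoc, ← ENNReal.ofReal_mul (by positivity),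
            inv_mul_cancel₀ hVpos.ne']
          simp
  exact (ENNReal.ofReal_le_ofReal_iff (by positivity)).1 key


lemma BB_vol {d n : ℕ} {r : ℝ} (hr : 0 ≤ r) :
    volume.real (BB d n r) = r ^ (d + n) * volume.real (BB d n 1) := by
  have := Measure.addHaar_real_closedBall' (volume : Measure (Pt d n)) 0 hr
  rw [this]; simp

lemma BB_pos {d n : ℕ} {r : ℝ} (hr : 0 < r) : 0 < volume.real (BB d n r) := by
  rw [Measure.real, ENNReal.toReal_pos_iff]
  exact ⟨Metric.measure_closedBall_pos _ _ hr, (isCompact_closedBall (0 : Pt d n) r).measure_lt_top⟩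

lemma tail_bd {d n : ℕ} (hd : 1 ≤ d) {M : ℝ} (hM : 0 < M) : ∃ A t₀ : ℝ, 0 ≤ A ∧ 0 < t₀ ∧
    ∀ f : Pt d n → ℂ, Nice 2 f → Mass d n f ≤ M → ∀ t, t₀ ≤ t →
    ∫ z in {z | t < ‖f z‖}, ‖f z‖^2 ∂(μP d n) ≤ A * t ^ (-(8 / ((d:ℝ) + n))) * lapSq d n f := by
  set V := volume.real (BB d n 1) with hV
  have hVp : 0 < V := BB_pos one_pos
  set q := 4 * M / V with hq
  have hqp : 0 < q := by positivity
  have hN : (0:ℝ) < (d:ℝ) + n := by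
    have : (1:ℝ) ≤ d := by exact_mod_cast hd
    positivity
  refine ⟨q ^ (4 / ((d:ℝ) + n)) * ((d + n : ℕ) : ℝ)^2, √q, by positivity, by positivity, ?_⟩
  intro f hf hfM t ht
  have htp : 0 < t := lt_of_lt_of_le (by positivity) ht
  have hqt : q ≤ t^2 := by
    rw [← Real.sq_sqrt hqp.le]; gcongr
  set r := (q / t^2) ^ (1 / ((d:ℝ) + n)) with hr
  have hrp : 0 < r := by positivity
  have hr1 : r ≤ 1 := Real.rpow_le_one (by positivity) ((div_le_one (by positivity)).2 hqt) (by positivity)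
  have hrN : r ^ (d + n) = q / t^2 := by
    rw [hr, ← Real.rpow_natCast, ← Real.rpow_mul (by positivity)]
    push_cast
    rw [one_div_mul_cancel hN.ne', Real.rpow_one]
  have hr4 : r ^ 4 = q ^ (4 / ((d:ℝ) + n)) * t ^ (-(8 / ((d:ℝ) + n))) := by
    rw [hr, ← Real.rpow_natCast, ← Real.rpow_mul (by positivity), Real.div_rpow hqp.le (by positivity),
      ← Real.rpow_natCast t 2, ← Real.rpow_mul htp.le, Real.rpow_neg htp.le, div_eq_mul_inv]
    congr 2
    · push_cast; ring
    · congr 1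
      push_cast; ring
  have := tail_le hf hrp (hr1.trans (by norm_num)) htp (by
    rw [BB_vol hrp.le, hrN, ← hV]
    have : t^2 * (q / t^2 * V) = 4 * M := by
      rw [hq]; field_simp
    rw [this]; linarith)
  rw [hr4] at this
  refine this.trans (le_of_eq ?_)
  ring

/-- subcritical bound -/
lemma npow_bd {d n : ℕ} (hd : 1 ≤ d) {α : ℝ} (hα : 0 < α) (hα' : α < 8 / ((d:ℝ)+n))
    {M : ℝ} (hM : 0 < M) {ε : ℝ} (hε : 0 < ε) : ∃ C : ℝ, 
    ∀ f : Pt d n → ℂ, Nice 2 f → Mass d n f ≤ M → 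
    Npow d n (α + 2) f ≤ ε * lapSq d n f + C := by
  obtain ⟨A, t₀, hA, ht₀, key⟩ := tail_bd (d := d) (n := n) hd hM
  set ρ := 8 / ((d:ℝ)+n) - α with hρ
  have hρp : 0 < ρ := by linarith
  set s : ℝ := 2 ^ (-ρ) with hs
  have hs1 : s < 1 := Real.rpow_lt_one_of_one_lt_of_neg (by norm_num) (by linarith)
  have hs0 : 0 < s := by positivity
  have hT : ∃ T : ℝ, t₀ ≤ T ∧ A * 2 ^ α * (1 - s)⁻¹ * T ^ (-ρ) ≤ ε := by
    have h1 : Tendsto (fun T : ℝ => A * 2 ^ α * (1 - s)⁻¹ * T ^ (-ρ)) atTop (nhds (A * 2 ^ α * (1 - s)⁻¹ * 0)) :=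
      (tendsto_rpow_neg_atTop hρp).const_mul _
    rw [mul_zero] at h1
    have h2 := h1.eventually (ge_mem_nhds hε)
    exact ((eventually_ge_atTop t₀).and h2).exists
  obtain ⟨T, hT0, hTε⟩ := hT
  have hTp : 0 < T := ht₀.trans_le hT0
  refine ⟨T ^ α * M, fun f hf hfM => ?_⟩
  have hL : 0 ≤ lapSq d n f := integral_nonneg fun z => by positivity
  obtain ⟨B, hB⟩ := hf.bdd
  have hKex : ∃ K : ℕ, B < 2 ^ K * T := by
    obtain ⟨K, hK⟩ := pow_unbounded_of_one_lt (B / T) (by norm_num : (1:ℝ) < 2)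
    exact ⟨K, (div_lt_iff₀ hTp).1 hK⟩
  obtain ⟨K, hK⟩ := hKex
  have hms : ∀ t : ℝ, MeasurableSet {z | t < ‖f z‖} := fun t =>
    (isOpen_lt continuous_const hf.cont.norm).measurableSet
  have ptw : ∀ z, ‖f z‖ ^ (α + 2) ≤ T ^ α * ‖f z‖^2 + ∑ k ∈ Finset.range K,
      (2 ^ (k+1) * T) ^ α * ({z | 2 ^ k * T < ‖f z‖}.indicator (fun z => ‖f z‖^2) z) := by
    intro z
    have e : ‖f z‖ ^ (α + 2) = ‖f z‖ ^ α * ‖f z‖^2 := by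
      rw [Real.rpow_add_of_nonneg (norm_nonneg _) hα.le (by norm_num)]
      norm_num
    have hnn : ∀ k ∈ Finset.range K, 0 ≤
      (2 ^ (k+1) * T) ^ α * ({z | 2 ^ k * T < ‖f z‖}.indicator (fun z => ‖f z‖^2) z) := by
      intro k _
      refine mul_nonneg (by positivity) (indicator_nonneg (fun z _ => by positivity) z)
    rw [e]
    by_cases hz : ‖f z‖ ≤ T
    · have h1 : ‖f z‖ ^ α * ‖f z‖^2 ≤ T ^ α * ‖f z‖^2 := by gcongr
      linarith [Finset.sum_nonneg hnn]
    · push Not at hz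
      have hex : ∃ k, ‖f z‖ ≤ 2 ^ k * T := ⟨K, (hB z).trans hK.le⟩
      classical
      set k := Nat.find hex with hk
      have hk1 : ‖f z‖ ≤ 2 ^ k * T := Nat.find_spec hex
      have hk2 : k ≤ K := Nat.find_min' hex ((hB z).trans hK.le)
      have hk0 : k ≠ 0 := by
        intro h0
        rw [h0] at hk1
        simp at hk1; linarith
      obtain ⟨m, hm⟩ := Nat.exists_eq_succ_of_ne_zero hk0
      have hm2 : 2 ^ m * T < ‖f z‖ := by
        have := Nat.find_min hex (m := m) (by rw [← hk]; omega)
        exact not_le.1 this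
      have h3 := Finset.single_le_sum hnn (Finset.mem_range.2 (by omega : m < K))
      have h4 : ({z | 2 ^ m * T < ‖f z‖}.indicator (fun z => ‖f z‖^2) z) = ‖f z‖^2 :=
        indicator_of_mem (by exact hm2) _
      simp only [h4] at h3
      have h5 : ‖f z‖ ^ α * ‖f z‖^2 ≤ (2 ^ (m+1) * T) ^ α * ‖f z‖^2 := by
        rw [hm] at hk1
        gcongr
      have h6 : 0 ≤ T ^ α * ‖f z‖^2 := by positivity
      linarith
  have hiI : ∀ t : ℝ, Integrable ({z | t < ‖f z‖}.indicator (fun z => ‖f z‖^2)) (μP d n) :=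
    fun t => hf.integrable_sq.indicator (hms t)
  have h1 : Npow d n (α + 2) f ≤ T ^ α * Mass d n f + ∑ k ∈ Finset.range K,
      (2 ^ (k+1) * T) ^ α * ∫ z in {z | 2 ^ k * T < ‖f z‖}, ‖f z‖^2 ∂(μP d n) := by
    rw [Npow, Mass, ← integral_const_mul]
    simp_rw [← integral_indicator (hms _), ← integral_const_mul]
    rw [← integral_finsetSum _ (fun k _ => (hiI _).const_mul _), ← integral_add
      (hf.integrable_sq.const_mul _) (integrable_finsetSum _ fun k _ => (hiI _).const_mul _)]
    refine integral_mono_of_nonneg (by filter_upwards with z; positivity) 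
      ((hf.integrable_sq.const_mul _).add (integrable_finsetSum _ fun k _ => (hiI _).const_mul _)) ?_
    filter_upwards with z
    exact ptw z
  have h2 : ∑ k ∈ Finset.range K,
      (2 ^ (k+1) * T) ^ α * ∫ z in {z | 2 ^ k * T < ‖f z‖}, ‖f z‖^2 ∂(μP d n) ≤
      ∑ k ∈ Finset.range K, (A * 2 ^ α * T ^ (-ρ) * lapSq d n f) * s ^ k := by
    refine Finset.sum_le_sum fun k _ => ?_
    have ht : t₀ ≤ 2 ^ k * T := by
      have : (1:ℝ) ≤ 2 ^ k := one_le_pow₀ (by norm_num)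
      nlinarith
    refine (mul_le_mul_of_nonneg_left (key f hf hfM _ ht) (by positivity)).trans (le_of_eq ?_)
    have h2k : (0:ℝ) < 2 ^ k * T := by positivity
    have e1 : ((2:ℝ) ^ (k+1) * T) ^ α = 2 ^ α * (2 ^ k * T) ^ α := by
      rw [← Real.mul_rpow (by norm_num) h2k.le]; congr 1; ring
    have e2 : ((2:ℝ) ^ k * T) ^ α * (2 ^ k * T) ^ (-(8 / ((d:ℝ) + n))) = T ^ (-ρ) * s ^ k := by
      rw [← Real.rpow_add h2k, show α + -(8 / ((d:ℝ) + n)) = -ρ by rw [hρ]; ring,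
        Real.mul_rpow (by positivity) hTp.le, hs, ← Real.rpow_natCast, ← Real.rpow_natCast,
        ← Real.rpow_mul (by norm_num), ← Real.rpow_mul (by norm_num), mul_comm (k:ℝ), mul_comm]
    rw [e1]
    calc _ = A * 2 ^ α * (((2:ℝ) ^ k * T) ^ α * (2 ^ k * T) ^ (-(8 / ((d:ℝ) + n)))) * lapSq d n f := by ring
      _ = _ := by rw [e2]; ring
  have h3 : ∑ k ∈ Finset.range K, (A * 2 ^ α * T ^ (-ρ) * lapSq d n f) * s ^ k ≤ ε * lapSq d n f := by
    rw [← Finset.mul_sum]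
    have hg : ∑ k ∈ Finset.range K, s ^ k ≤ (1 - s)⁻¹ := by
      rw [← tsum_geometric_of_lt_one hs0.le hs1]
      exact (summable_geometric_of_lt_one hs0.le hs1).sum_le_tsum _ (fun k _ => by positivity)
    calc _ ≤ (A * 2 ^ α * T ^ (-ρ) * lapSq d n f) * (1 - s)⁻¹ := by gcongr
      _ = (A * 2 ^ α * (1 - s)⁻¹ * T ^ (-ρ)) * lapSq d n f := by ring
      _ ≤ _ := by gcongr
  have h4 : T ^ α * Mass d n f ≤ T ^ α * M := by gcongr
  linarith

lemma En_bd {d n : ℕ} (hd : 1 ≤ d) {α : ℝ} (β : ℝ) (hα : 0 < α) (hα' : α < 8 / ((d:ℝ)+n))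
    {M : ℝ} (hM : 0 < M) : ∃ C : ℝ, 
    ∀ f : Pt d n → ℂ, Nice 2 f → Mass d n f ≤ M → C ≤ En d n β α f := by
  obtain ⟨C, hC⟩ := npow_bd (n := n) hd hα hα' hM (ε := 1/4) (by norm_num)
  set δ := 1 / (2 * (|β| + 1)) with hδ
  have hδp : 0 < δ := by positivity
  refine ⟨-(|β|/2 * (1 / (4 * δ) * M)) - |C|, fun f hf hfM => ?_⟩
  have h1 := hC f hf hfM
  have h2 := grad_le hf hδp
  have hL : 0 ≤ lapSq d n f := integral_nonneg fun z => by positivity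
  have hN : 0 ≤ Npow d n (α+2) f := integral_nonneg fun z => by positivity
  have hG : 0 ≤ gradSq d n f := add_nonneg (integral_nonneg fun z => by positivity)
    (integral_nonneg fun z => by positivity)
  have h3 : -(β / 2 * gradSq d n f) ≤ |β|/2 * (δ * lapSq d n f + 1 / (4 * δ) * M) := by
    calc -(β / 2 * gradSq d n f) ≤ |β|/2 * gradSq d n f := by
          have := neg_abs_le β
          nlinarith
      _ ≤ |β|/2 * (δ * lapSq d n f + 1 / (4 * δ) * Mass d n f) := by gcongr
      _ ≤ _ := by gcongr
  have h4 : |β|/2 * δ ≤ 1/4 := by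
    rw [hδ]
    have : 0 ≤ |β| := abs_nonneg β
    rw [div_mul_div_comm, div_le_div_iff₀ (by positivity) (by norm_num)]
    linarith
  have h5 : 1/(α+2) * Npow d n (α+2) f ≤ Npow d n (α+2) f := by
    refine mul_le_of_le_one_left hN ?_
    rw [div_le_one (by linarith)]; linarith
  have h6 : |β|/2 * (δ * lapSq d n f) ≤ 1/4 * lapSq d n f := by
    rw [← mul_assoc]; gcongr
  have := le_abs_self C
  unfold En
  linarith


lemma Nice.inH2 {d n : ℕ} {f : Pt d n → ℂ} (h : Nice 2 f) : InH2 d n f := by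
  refine ⟨by exact_mod_cast h.cd, h.per, h.integrable_sq, ?_, ?_⟩
  · simp_rw [grad_eq]
    exact integrable_finsetSum _ fun k _ => (h.D _).integrable_sq
  · have : hessInt d n f = fun z => ∑ k, ∑ l, ‖BNLS.D (ee k) (BNLS.D (ee l) f) z‖^2 := by
      funext z; exact hess_eq f z
    rw [this]
    exact integrable_finsetSum _ fun k _ => integrable_finsetSum _ fun l _ => ((h.D _).D _).integrable_sq

lemma D_add' {d n : ℕ} {f g : Pt d n → ℂ} (h : ContDiff ℝ 1 f) (h' : ContDiff ℝ 1 g) (w : Pt d n) :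
    D w (fun z => f z + g z) = fun z => D w f z + D w g z := by
  funext z
  simp only [D]
  rw [fderiv_fun_add (h.differentiable (by norm_num) z) (h'.differentiable (by norm_num) z)]
  rfl

lemma D_mul' {d n : ℕ} {f g : Pt d n → ℂ} (h : ContDiff ℝ 1 f) (h' : ContDiff ℝ 1 g) (w : Pt d n) :
    D w (fun z => f z * g z) = fun z => D w f z * g z + f z * D w g z := by
  funext z
  simp only [D]
  rw [fderiv_fun_mul (h.differentiable (by norm_num) z) (h'.differentiable (by norm_num) z)]
  simp; ring

lemma D_const_mul {d n : ℕ} {f : Pt d n → ℂ} (h : ContDiff ℝ 1 f) (c : ℂ) (w : Pt d n) :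
    D w (fun z => c * f z) = fun z => c * D w f z := by
  funext z
  simp only [D]
  rw [fderiv_const_mul (h.differentiable (by norm_num) z)]
  simp

lemma lap_const_mul {d n : ℕ} {f : Pt d n → ℂ} (h : Nice 2 f) (c : ℂ) :
    lap d n (fun z => c * f z) = fun z => c * lap d n f z := by
  funext z
  simp_rw [lap_eq, D_const_mul (h.mono (by norm_num : 1 ≤ 2)).cd c, D_const_mul (h.D _).cd c, Finset.mul_sum]

lemma lap_add {d n : ℕ} {f g : Pt d n → ℂ} (h : Nice 2 f) (h' : Nice 2 g) :
    lap d n (fun z => f z + g z) = fun z => lap d n f z + lap d n g z := by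
  funext z
  simp_rw [lap_eq, D_add' (h.mono (by norm_num : 1 ≤ 2)).cd (h'.mono (by norm_num : 1 ≤ 2)).cd,
    D_add' (h.D _).cd (h'.D _).cd, Finset.sum_add_distrib]

lemma Nice.const_mul {d n : ℕ} {f : Pt d n → ℂ} {m : ℕ} (h : Nice m f) (c : ℂ) :
    Nice m (fun z => c * f z) where
  cd := contDiff_const.mul h.cd
  per := per_comp h.per _
  van := by
    obtain ⟨R, hR⟩ := h.van
    exact ⟨R, fun z hz => by simp [hR z hz]⟩

lemma Nice.add {d n : ℕ} {f g : Pt d n → ℂ} {m : ℕ} (h : Nice m f) (h' : Nice m g) :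
    Nice m (fun z => f z + g z) where
  cd := h.cd.add h'.cd
  per := per_comp2 h.per h'.per _
  van := by
    obtain ⟨R, hR⟩ := h.van
    obtain ⟨R', hR'⟩ := h'.van
    exact ⟨max R R', fun z hz => by simp [hR z ((le_max_left _ _).trans_lt hz), hR' z ((le_max_right _ _).trans_lt hz)]⟩

lemma mass_scale {d n : ℕ} (f : Pt d n → ℂ) (t : ℝ) :
    Mass d n (fun z => (t:ℂ) * f z) = t^2 * Mass d n f := by
  simp_rw [Mass, norm_mul, mul_pow, integral_const_mul]
  simp

lemma En_scale {d n : ℕ} (β α : ℝ) {f : Pt d n → ℂ} (h : Nice 2 f) {t : ℝ} (ht : 0 ≤ t) :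
    En d n β α (fun z => (t:ℂ) * f z) = t^2 * ((1/2) * lapSq d n f + (β/2) * gradSq d n f)
      - t ^ (α + 2) * ((1/(α+2)) * Npow d n (α+2) f) := by
  have h1 : Nice 1 f := h.mono (by norm_num)
  have e1 : lapSq d n (fun z => (t:ℂ) * f z) = t^2 * lapSq d n f := by
    simp_rw [lapSq, lap_const_mul h, norm_mul, mul_pow, integral_const_mul]
    simp
  have e2 : gradSq d n (fun z => (t:ℂ) * f z) = t^2 * gradSq d n f := by
    simp_rw [gradSq_eq h1, gradSq_eq (h1.const_mul _), D_const_mul h1.cd, norm_mul, mul_pow,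
      integral_const_mul, Finset.mul_sum]
    simp
  have e3 : Npow d n (α+2) (fun z => (t:ℂ) * f z) = t ^ (α + 2) * Npow d n (α+2) f := by
    simp_rw [Npow, norm_mul, Real.mul_rpow (norm_nonneg _) (norm_nonneg _), integral_const_mul]
    simp [abs_of_nonneg ht]
  rw [En, e1, e2, e3]; ring

lemma int_add_disj {d n : ℕ} {F G : Pt d n → ℂ} (hF : Nice 0 F) (hG : Nice 0 G) (w : Pt d n)
    (hd : ∀ z, F z = 0 ∨ G (z + w) = 0) {p : ℂ → ℝ} (hp : Continuous p) (hp0 : p 0 = 0) :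
    ∫ z, p (F z + G (z + w)) ∂(μP d n) = ∫ z, p (F z) ∂(μP d n) + ∫ z, p (G z) ∂(μP d n) := by
  have hi : ∀ {F : Pt d n → ℂ}, Nice 0 F → Integrable (fun z => p (F z)) (μP d n) := by
    intro F hF
    obtain ⟨R, hR⟩ := hF.van
    exact integrable_of_van (hp.comp hF.cont) (R := R) fun z hz => by simp [hR z hz, hp0]
  have e : ∀ z, p (F z + G (z + w)) = p (F z) + p (G (z + w)) := by
    intro z
    rcases hd z with h | h <;> simp [h, hp0]
  simp_rw [e]
  rw [integral_add (hi hF) (hi (hG.shift w))]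
  congr 1
  exact (per_comp hG.per p).integral_add (hp.comp hG.cont).stronglyMeasurable w

lemma glue {d n : ℕ} (hd : 1 ≤ d) (β : ℝ) {α : ℝ} (hα : 0 < α) {f g : Pt d n → ℂ} (hf : Nice 2 f) (hg : Nice 2 g) :
    ∃ v : Pt d n → ℂ, Nice 2 v ∧ Mass d n v = Mass d n f + Mass d n g ∧
      En d n β α v = En d n β α f + En d n β α g := by
  obtain ⟨R, hR⟩ := hf.van
  obtain ⟨R', hR'⟩ := hg.van
  set L := |R| + |R'| + 1
  set w : Pt d n := (fun _ => L, 0)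
  have : Nonempty (Fin d) := ⟨⟨0, hd⟩⟩
  have hw : ‖w.1‖ = L := by
    have : 0 ≤ L := by positivity
    simp [w, abs_of_nonneg this]
  have dich : ∀ z : Pt d n, R < ‖z.1‖ ∨ R' < ‖(z + w).1‖ := by
    intro z
    by_contra! hc
    have h1 : ‖w.1‖ ≤ ‖(z + w).1‖ + ‖z.1‖ := by
      have := norm_sub_le (z + w).1 z.1
      simpa using this
    have := le_abs_self R
    have := le_abs_self R'
    rw [hw] at h1
    linarith [hc.1, hc.2, show L = |R| + |R'| + 1 from rfl]
  have hf1 : Nice 1 f := hf.mono (by norm_num)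
  have hg1 : Nice 1 g := hg.mono (by norm_num)
  have hf0 : Nice 0 f := hf.mono (by norm_num)
  have hg0 : Nice 0 g := hg.mono (by norm_num)
  have hgs := hg.shift w
  have hlz : ∀ {f : Pt d n → ℂ} {R : ℝ}, (∀ z : Pt d n, R < ‖z.1‖ → f z = 0) →
      (∀ z : Pt d n, R < ‖z.1‖ → lap d n f z = 0) := by
    intro f R h z hz
    rw [lap_eq]
    exact Finset.sum_eq_zero fun k _ => van_D (van_D h _) _ z hz
  have p2 : Continuous fun c : ℂ => ‖c‖^2 := by fun_prop
  have pa : Continuous fun c : ℂ => ‖c‖^(α+2) := continuous_norm.rpow_const fun _ => Or.inr (by linarith)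
  have hlaps : lap d n (fun z => g (z + w)) = fun z => lap d n g (z + w) := by
    funext z
    simp_rw [lap_eq]
    refine Finset.sum_congr rfl fun k _ => ?_
    have : D (ee k) (fun z => g (z + w)) = fun z => D (ee k) g (z + w) := funext fun z => D_shift g w _ z
    rw [this, D_shift]
  refine ⟨fun z => f z + g (z + w), hf.add hgs, ?_, ?_⟩
  · exact int_add_disj hf0 hg0 w (fun z => (dich z).imp (hR z) (hR' _)) p2 (by simp)
  · have e1 : lapSq d n (fun z => f z + g (z + w)) = lapSq d n f + lapSq d n g := by
      simp only [lapSq]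
      rw [lap_add hf hgs, hlaps]
      exact int_add_disj hf.lap hg.lap w (fun z => (dich z).imp (hlz hR z) (hlz hR' _)) p2 (by simp)
    have e2 : gradSq d n (fun z => f z + g (z + w)) = gradSq d n f + gradSq d n g := by
      rw [gradSq_eq hf1, gradSq_eq hg1, gradSq_eq (hf1.add (hg1.shift w)), ← Finset.sum_add_distrib]
      refine Finset.sum_congr rfl fun k _ => ?_
      rw [D_add' hf1.cd (hg1.shift w).cd]
      simp only [D_shift]
      exact int_add_disj (hf1.D _) (hg1.D _) w (fun z => (dich z).imp (van_D hR _ z) (van_D hR' _ _)) p2 (by simp)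
    have e3 : Npow d n (α+2) (fun z => f z + g (z + w)) = Npow d n (α+2) f + Npow d n (α+2) g :=
      int_add_disj hf0 hg0 w (fun z => (dich z).imp (hR z) (hR' _)) pa
        (by simp only [norm_zero]; exact Real.zero_rpow (by linarith))
    rw [En, e1, e2, e3, En, En]; ring

/-- cutoff -/
def eta (d n : ℕ) (z : Pt d n) : ℂ :=
  (((⟨1, 2, by norm_num, by norm_num⟩ : ContDiffBump (0 : Fin d → ℝ)) z.1 : ℝ) : ℂ)

lemma eta_nice (d n m : ℕ) : Nice m (eta d n) where
  cd := by
    have h1 : ContDiff ℝ m fun z : Pt d n =>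
        (⟨1, 2, by norm_num, by norm_num⟩ : ContDiffBump (0 : Fin d → ℝ)) z.1 :=
      (ContDiffBump.contDiff _).comp contDiff_fst
    exact Complex.ofRealCLM.contDiff.comp h1
  per := by intro j p; rfl
  van := by
    refine ⟨2, fun z hz => ?_⟩
    simp only [eta, Complex.ofReal_eq_zero]
    exact ContDiffBump.zero_of_le_dist _ (by simpa using hz.le)

lemma eta_one {d n : ℕ} {z : Pt d n} (hz : ‖z.1‖ ≤ 1) : eta d n z = 1 := by
  simp only [eta, Complex.ofReal_eq_one]
  exact ContDiffBump.one_of_mem_closedBall _ (by simpa using hz)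

lemma eta_le {d n : ℕ} (z : Pt d n) : ‖eta d n z‖ ≤ 1 := by
  simp only [eta, Complex.norm_real, Real.norm_eq_abs, abs_of_nonneg (ContDiffBump.nonneg _)]
  exact ContDiffBump.le_one _

/-- there are elements of every positive mass -/
lemma nonempty_S (d n : ℕ) {c : ℝ} (hc : 0 < c) : (Sset d n c).Nonempty := by
  have hN := eta_nice d n 2
  have hM : 0 < Mass d n (eta d n) := by
    have h1 : (μP d n).real (Metric.closedBall 0 1 ×ˢ univ) ≤ Mass d n (eta d n) := by
      rw [← integral_indicator_one (Metric.isClosed_closedBall.measurableSet.prod MeasurableSet.univ)]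
      refine integral_mono_of_nonneg ?_ hN.integrable_sq ?_
      · filter_upwards with z
        exact indicator_nonneg (fun _ _ => zero_le_one) z
      · filter_upwards with z
        by_cases hz : z ∈ (Metric.closedBall 0 1 ×ˢ univ : Set (Pt d n))
        · rw [indicator_of_mem hz, eta_one (by simpa using hz.1)]; simp
        · rw [indicator_of_notMem hz]; positivity
    refine lt_of_lt_of_le ?_ h1
    rw [Measure.real, ENNReal.toReal_pos_iff, μP, Measure.prod_prod]
    have hT : μT n univ = ENNReal.ofReal (2*π) ^ n := by
      rw [μT_eq, Measure.pi_univ]; simp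
    rw [hT]
    constructor
    · refine ENNReal.mul_pos (Metric.measure_closedBall_pos _ _ one_pos).ne' ?_
      exact pow_ne_zero _ (by simp [Real.pi_pos])
    · exact ENNReal.mul_lt_top (isCompact_closedBall _ _).measure_lt_top (ENNReal.pow_lt_top ENNReal.ofReal_lt_top)
  refine ⟨fun z => ((√(c / Mass d n (eta d n)) : ℝ) : ℂ) * eta d n z, (hN.const_mul _).inH2, ?_⟩
  rw [mass_scale, Real.sq_sqrt (by positivity)]
  field_simp


/-- rescaled cutoff -/
def cut (d n : ℕ) (s : ℝ) (z : Pt d n) : ℂ := eta d n (s • z)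

lemma D_smul {d n : ℕ} {f : Pt d n → ℂ} (hf : ContDiff ℝ 1 f) (s : ℝ) (w : Pt d n) :
    D w (fun z => f (s • z)) = fun z => (s : ℂ) * D w f (s • z) := by
  funext z
  simp only [D]
  have h1 : HasFDerivAt (fun z : Pt d n => s • z) (s • ContinuousLinearMap.id ℝ (Pt d n)) z :=
    (hasFDerivAt_id z).const_smul s
  have h2 : HasFDerivAt f (fderiv ℝ f (s • z)) (s • z) :=
    (hf.differentiable (by norm_num) (s • z)).hasFDerivAt
  have h3 := (h2.comp z h1).fderiv
  rw [show (fun z => f (s • z)) = f ∘ (fun z : Pt d n => s • z) from rfl, h3]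
  simp

lemma cut_nice (d n m : ℕ) {s : ℝ} (hs : 0 < s) : Nice m (cut d n s) where
  cd := (eta_nice d n m).cd.comp (contDiff_const_smul s)
  per := by intro j p; rfl
  van := by
    obtain ⟨R, hR⟩ := (eta_nice d n m).van
    refine ⟨R / s, fun z hz => hR _ ?_⟩
    rw [Prod.smul_fst, norm_smul, Real.norm_eq_abs, abs_of_pos hs]
    rwa [div_lt_iff₀' hs] at hz

lemma D_cut (d n : ℕ) (s : ℝ) (w : Pt d n) :
    D w (cut d n s) = fun z => (s : ℂ) * D w (eta d n) (s • z) :=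
  D_smul (eta_nice d n 1).cd s w

lemma DD_cut (d n : ℕ) (s : ℝ) (v w : Pt d n) :
    D v (D w (cut d n s)) = fun z => (s : ℂ) * ((s : ℂ) * D v (D w (eta d n)) (s • z)) := by
  have h : Nice 1 (D w (eta d n)) := (eta_nice d n 2).D w
  have h2 : ContDiff ℝ 1 (fun z => D w (eta d n) (s • z)) := h.cd.comp (contDiff_const_smul s)
  rw [D_cut, D_const_mul h2, D_smul h.cd]

lemma cut_bd (d n : ℕ) : ∃ B : ℝ, 0 ≤ B ∧ ∀ s : ℝ, 0 < s → s ≤ 1 → ∀ z : Pt d n,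
    ‖cut d n s z‖ ≤ B ∧ (∀ k : Fin d ⊕ Fin n, ‖D (ee k) (cut d n s) z‖ ≤ B) ∧
    ∀ k l : Fin d ⊕ Fin n, ‖D (ee k) (D (ee l) (cut d n s)) z‖ ≤ B := by
  choose C1 h1 using fun k : Fin d ⊕ Fin n => ((eta_nice d n 1).D (ee k)).bdd
  choose C2 h2 using fun k : Fin d ⊕ Fin n => fun l : Fin d ⊕ Fin n =>
    (((eta_nice d n 2).D (ee l)).D (ee k)).bdd
  have p1 : ∀ k, 0 ≤ C1 k := fun k => (norm_nonneg _).trans (h1 k 0)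
  have p2 : ∀ k l, 0 ≤ C2 k l := fun k l => (norm_nonneg _).trans (h2 k l 0)
  have q1 : 0 ≤ ∑ k, C1 k := Finset.sum_nonneg fun k _ => p1 k
  have q2 : 0 ≤ ∑ k, ∑ l, C2 k l := Finset.sum_nonneg fun k _ => Finset.sum_nonneg fun l _ => p2 k l
  refine ⟨1 + (∑ k, C1 k) + ∑ k, ∑ l, C2 k l, by positivity, ?_⟩
  intro s hs hs1 z
  refine ⟨?_, ?_, ?_⟩
  · have := eta_le (d := d) (n := n) (s • z)
    change ‖eta d n (s • z)‖ ≤ _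
    linarith
  · intro k
    rw [D_cut, norm_mul, Complex.norm_real, Real.norm_eq_abs, abs_of_pos hs]
    have a1 := h1 k (s • z)
    have a2 : C1 k ≤ ∑ k, C1 k := Finset.single_le_sum (fun k _ => p1 k) (Finset.mem_univ k)
    have a3 := mul_le_of_le_one_left (norm_nonneg (D (ee k) (eta d n) (s • z))) hs1
    linarith
  · intro k l
    rw [DD_cut, norm_mul, norm_mul, Complex.norm_real, Real.norm_eq_abs, abs_of_pos hs]
    have a1 := h2 k l (s • z)
    have a2 : C2 k l ≤ ∑ l, C2 k l := Finset.single_le_sum (fun l _ => p2 k l) (Finset.mem_univ l)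
    have a4 : ∑ l, C2 k l ≤ ∑ k, ∑ l, C2 k l :=
      Finset.single_le_sum (f := fun k => ∑ l, C2 k l)
        (fun k _ => Finset.sum_nonneg fun l _ => p2 k l) (Finset.mem_univ k)
    have a3 := mul_le_of_le_one_left (norm_nonneg (D (ee k) (D (ee l) (eta d n)) (s • z))) hs1
    have a5 := mul_le_of_le_one_left (mul_nonneg hs.le (norm_nonneg (D (ee k) (D (ee l) (eta d n)) (s • z)))) hs1
    linarith

/-- pointwise first-order majorant -/
def qq {d n : ℕ} (u : Pt d n → ℂ) (z : Pt d n) : ℝ :=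
  ‖u z‖ + (∑ k, ‖D (ee k) u z‖) + ∑ k, ∑ l, ‖D (ee k) (D (ee l) u) z‖

lemma qq_1 {d n : ℕ} (u : Pt d n → ℂ) (z : Pt d n) : ‖u z‖ ≤ qq u z := by
  have : 0 ≤ ∑ k, ‖D (ee k) u z‖ := by positivity
  have : 0 ≤ ∑ k, ∑ l, ‖D (ee k) (D (ee l) u) z‖ := by positivity
  rw [qq]; linarith

lemma qq_2 {d n : ℕ} (u : Pt d n → ℂ) (z : Pt d n) (k) : ‖D (ee k) u z‖ ≤ qq u z := by
  have : ‖D (ee k) u z‖ ≤ ∑ k, ‖D (ee k) u z‖ :=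
    Finset.single_le_sum (f := fun k => ‖D (ee k) u z‖) (fun k _ => norm_nonneg _) (Finset.mem_univ k)
  have : 0 ≤ ∑ k, ∑ l, ‖D (ee k) (D (ee l) u) z‖ := by positivity
  have := norm_nonneg (u z)
  rw [qq]; linarith

lemma qq_3 {d n : ℕ} (u : Pt d n → ℂ) (z : Pt d n) (k l) : ‖D (ee k) (D (ee l) u) z‖ ≤ qq u z := by
  have : 0 ≤ ∑ k, ‖D (ee k) u z‖ := by positivity
  have : ‖D (ee k) (D (ee l) u) z‖ ≤ ∑ l, ‖D (ee k) (D (ee l) u) z‖ :=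
    Finset.single_le_sum (f := fun l => ‖D (ee k) (D (ee l) u) z‖) (fun k _ => norm_nonneg _) (Finset.mem_univ l)
  have : ∑ l, ‖D (ee k) (D (ee l) u) z‖ ≤ ∑ k, ∑ l, ‖D (ee k) (D (ee l) u) z‖ :=
    Finset.single_le_sum (f := fun k => ∑ l, ‖D (ee k) (D (ee l) u) z‖)
      (fun k _ => by positivity) (Finset.mem_univ k)
  have := norm_nonneg (u z)
  rw [qq]; linarith

lemma cont_D {d n : ℕ} {u : Pt d n → ℂ} (h : ContDiff ℝ 2 u) (w : Pt d n) : Continuous (D w u) :=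
  (cd_D (m := 1) (by exact_mod_cast h) w).continuous

lemma cont_DD {d n : ℕ} {u : Pt d n → ℂ} (h : ContDiff ℝ 2 u) (v w : Pt d n) : Continuous (D v (D w u)) :=
  (cd_D (m := 0) (cd_D (m := 1) (by exact_mod_cast h) w) v).continuous

lemma qq_int {d n : ℕ} {u : Pt d n → ℂ} (h : InH2 d n u) :
    Integrable (fun z => (qq u z)^2) (μP d n) := by
  obtain ⟨hc, -, i0, i1, i2⟩ := h
  have i1' : Integrable (fun z => ∑ k, ‖D (ee k) u z‖^2) (μP d n) := by
    simpa only [grad_eq] using i1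
  have i2' : Integrable (fun z => ∑ k, ∑ l, ‖D (ee k) (D (ee l) u) z‖^2) (μP d n) := by
    have : hessInt d n u = fun z => ∑ k, ∑ l, ‖D (ee k) (D (ee l) u) z‖^2 := funext (hess_eq u)
    rwa [this] at i2
  have key : ∀ {F : Pt d n → ℂ}, Continuous F → Integrable (fun z => ‖F z‖^2) (μP d n) →
      MemLp (fun z => ‖F z‖) 2 (μP d n) := by
    intro F hF hi
    rw [memLp_two_iff_integrable_sq hF.norm.aestronglyMeasurable]
    exact hi
  have m0 := key hc.continuous i0
  have m1 : ∀ k, MemLp (fun z => ‖D (ee k) u z‖) 2 (μP d n) := by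
    intro k
    refine key (cont_D hc _) (i1'.mono' ((cont_D hc _).norm.pow 2).aestronglyMeasurable ?_)
    filter_upwards with z
    rw [Real.norm_eq_abs, abs_of_nonneg (by positivity)]
    exact Finset.single_le_sum (f := fun k => ‖D (ee k) u z‖^2) (fun k _ => by positivity) (Finset.mem_univ k)
  have m2 : ∀ k l, MemLp (fun z => ‖D (ee k) (D (ee l) u) z‖) 2 (μP d n) := by
    intro k l
    refine key (cont_DD hc _ _) (i2'.mono' ((cont_DD hc _ _).norm.pow 2).aestronglyMeasurable ?_)
    filter_upwards with z
    rw [Real.norm_eq_abs, abs_of_nonneg (by positivity)]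
    refine (Finset.single_le_sum (f := fun l => ‖D (ee k) (D (ee l) u) z‖^2) (fun k _ => by positivity) (Finset.mem_univ l)).trans ?_
    exact Finset.single_le_sum (f := fun k => ∑ l, ‖D (ee k) (D (ee l) u) z‖^2) (fun k _ => by positivity) (Finset.mem_univ k)
  have m : MemLp (qq u) 2 (μP d n) :=
    (m0.add (memLp_finsetSum _ fun k _ => m1 k)).add
      (memLp_finsetSum _ fun k _ => memLp_finsetSum _ fun l _ => m2 k l)
  exact m.integrable_sq

lemma trunc_bd (d n : ℕ) : ∃ A : ℝ, 0 ≤ A ∧ ∀ s : ℝ, 0 < s → s ≤ 1 → ∀ u : Pt d n → ℂ, ContDiff ℝ 2 u →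
    ∀ z, ‖cut d n s z * u z‖ ≤ A * qq u z ∧
      (∀ k : Fin d ⊕ Fin n, ‖D (ee k) (fun z => cut d n s z * u z) z‖ ≤ A * qq u z) ∧
      ‖lap d n (fun z => cut d n s z * u z) z‖ ≤ A * qq u z := by
  obtain ⟨B, hB, hb⟩ := cut_bd d n
  set N : ℝ := ((Fintype.card (Fin d ⊕ Fin n) : ℕ) : ℝ)
  have hN : 0 ≤ N := by positivity
  refine ⟨(N + 1) * (4 * B), by positivity, ?_⟩
  intro s hs hs1 u hu z
  obtain ⟨b0, b1, b2⟩ := hb s hs hs1 z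
  have q0 : 0 ≤ qq u z := (norm_nonneg _).trans (qq_1 u z)
  have hmul : ∀ a b : ℂ, ‖a‖ ≤ B → ‖b‖ ≤ qq u z → ‖a * b‖ ≤ B * qq u z := by
    intro a b ha hb'
    rw [norm_mul]
    exact mul_le_mul ha hb' (norm_nonneg _) hB
  have hBq : 0 ≤ B * qq u z := mul_nonneg hB q0
  have hNBq : 0 ≤ N * (B * qq u z) := mul_nonneg hN hBq
  have cc : ContDiff ℝ 2 (cut d n s) := (cut_nice d n 2 hs).cd
  have cc1 : ContDiff ℝ 1 (cut d n s) := (cut_nice d n 1 hs).cd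
  have hu1 : ContDiff ℝ 1 u := hu.of_le (by norm_num)
  have hD : ∀ k : Fin d ⊕ Fin n, ‖D (ee k) (fun z => cut d n s z * u z) z‖ ≤ 2 * (B * qq u z) := by
    intro k
    rw [D_mul' cc1 hu1]
    refine (norm_add_le _ _).trans ?_
    have := hmul _ _ (b1 k) (qq_1 u z)
    have := hmul _ _ b0 (qq_2 u z k)
    linarith
  have hDD : ∀ k : Fin d ⊕ Fin n, ‖D (ee k) (D (ee k) (fun z => cut d n s z * u z)) z‖ ≤ 4 * (B * qq u z) := by
    intro k
    have dc : ContDiff ℝ 1 (D (ee k) (cut d n s)) := by exact_mod_cast cd_D (m := 1) (by exact_mod_cast cc) (ee k)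
    have du : ContDiff ℝ 1 (D (ee k) u) := by exact_mod_cast cd_D (m := 1) (by exact_mod_cast hu) (ee k)
    rw [D_mul' cc1 hu1, D_add' (dc.mul hu1) (cc1.mul du), D_mul' dc hu1, D_mul' cc1 du]
    have t1 := hmul _ _ (b2 k k) (qq_1 u z)
    have t2 := hmul _ _ (b1 k) (qq_2 u z k)
    have t3 := hmul _ _ b0 (qq_3 u z k k)
    refine (norm_add_le _ _).trans ?_
    have t4 := norm_add_le (D (ee k) (D (ee k) (cut d n s)) z * u z) (D (ee k) (cut d n s) z * D (ee k) u z)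
    have t5 := norm_add_le (D (ee k) (cut d n s) z * D (ee k) u z) (cut d n s z * D (ee k) (D (ee k) u) z)
    linarith
  refine ⟨?_, ?_, ?_⟩
  · have := hmul _ _ b0 (qq_1 u z)
    nlinarith
  · intro k
    have := hD k
    nlinarith
  · rw [lap_eq]
    refine (norm_sum_le _ _).trans ?_
    refine (Finset.sum_le_sum fun k _ => hDD k).trans ?_
    rw [Finset.sum_const, nsmul_eq_mul, Finset.card_univ]
    change N * _ ≤ _
    nlinarith

lemma dct_sq {d n : ℕ} {q : Pt d n → ℝ} (hq : Integrable (fun z => (q z)^2) (μP d n)) (A : ℝ)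
    {F : ℕ → Pt d n → ℂ} {G : Pt d n → ℂ} (hF : ∀ m, Continuous (F m))
    (hb : ∀ m z, ‖F m z‖ ≤ A * q z) (he : ∀ z, ∀ᶠ m in atTop, F m z = G z) :
    Tendsto (fun m => ∫ z, ‖F m z‖^2 ∂(μP d n)) atTop (nhds (∫ z, ‖G z‖^2 ∂(μP d n))) := by
  refine tendsto_integral_of_dominated_convergence (fun z => A^2 * (q z)^2) (fun m => ((hF m).norm.pow 2).aestronglyMeasurable)
    (hq.const_mul _) (fun m => ?_) ?_
  · filter_upwards with z
    rw [Real.norm_eq_abs, abs_of_nonneg (by positivity), ← mul_pow]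
    exact pow_le_pow_left₀ (norm_nonneg _) (hb m z) 2
  · filter_upwards with z
    refine tendsto_const_nhds.congr' ?_
    filter_upwards [he z] with m hm
    rw [hm]

lemma gradSq_eq' {d n : ℕ} {u : Pt d n → ℂ} (h : InH2 d n u) :
    gradSq d n u = ∑ k, ∫ z, ‖D (ee k) u z‖^2 ∂(μP d n) := by
  have hi : ∀ k, Integrable (fun z => ‖D (ee k) u z‖^2) (μP d n) := by
    intro k
    refine (qq_int h).mono' ((cont_D h.1 _).norm.pow 2).aestronglyMeasurable ?_
    filter_upwards with z
    rw [Real.norm_eq_abs, abs_of_nonneg (by positivity)]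
    exact pow_le_pow_left₀ (norm_nonneg _) (qq_2 u z k) 2
  rw [gradSq, gradXSq, gradYSq, Fintype.sum_sum_type, integral_finsetSum, integral_finsetSum]
  · rfl
  · intro j _
    exact hi (Sum.inr j)
  · intro j _
    exact hi (Sum.inl j)

lemma D_congr {d n : ℕ} {f g : Pt d n → ℂ} {z : Pt d n} (h : f =ᶠ[nhds z] g) (w : Pt d n) :
    D w f =ᶠ[nhds z] D w g := by
  filter_upwards [h.fderiv (𝕜 := ℝ)] with x hx
  simp only [D, hx]

/-- truncation and normalization -/
lemma trunc {d n : ℕ} {u : Pt d n → ℂ} (hu : InH2 d n u) (β : ℝ) {α c ε : ℝ} (hα : 0 < α) (hc : 0 < c)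
    (hm : Mass d n u = c) (hε : 0 < ε) :
    ∃ v : Pt d n → ℂ, Nice 2 v ∧ Mass d n v = c ∧ En d n β α v ≤ En d n β α u + ε := by
  obtain ⟨A, hA, hb⟩ := trunc_bd d n
  set s : ℕ → ℝ := fun m => 1 / ((m : ℝ) + 1)
  have hs : ∀ m, 0 < s m := fun m => by positivity
  have hs1 : ∀ m, s m ≤ 1 := fun m => by
    simp only [s]
    rw [div_le_one (by positivity)]
    have : (0:ℝ) ≤ m := by positivity
    linarith
  set U : ℕ → Pt d n → ℂ := fun m z => cut d n (s m) z * u z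
  have hU : ∀ m, Nice 2 (U m) := fun m => by
    refine ⟨(cut_nice d n 2 (hs m)).cd.mul (by exact_mod_cast hu.1), per_comp2 (cut_nice d n 2 (hs m)).per hu.2.1 _, ?_⟩
    obtain ⟨R, hR⟩ := (cut_nice d n 2 (hs m)).van
    exact ⟨R, fun z hz => by simp [U, hR z hz]⟩
  have hloc : ∀ z, ∀ᶠ m in atTop, U m =ᶠ[nhds z] u := by
    intro z
    obtain ⟨K, hK⟩ := exists_nat_ge (‖z.1‖ + 1)
    filter_upwards [eventually_ge_atTop K] with m hmK
    have : ∀ᶠ x : Pt d n in nhds z, ‖x.1‖ < ‖z.1‖ + 1 :=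
      (continuous_fst.norm.continuousAt (x := z)).eventually_lt continuousAt_const (by linarith)
    filter_upwards [this] with x hx
    have h1 : cut d n (s m) x = 1 := by
      refine eta_one ?_
      rw [Prod.smul_fst, norm_smul, Real.norm_eq_abs, abs_of_pos (hs m)]
      have : (K:ℝ) ≤ m := by exact_mod_cast hmK
      simp only [s]
      rw [one_div_mul_eq_div, div_le_one (by positivity)]
      linarith
    simp [U, h1]
  have hq := qq_int hu
  have hU1 : ∀ m, Nice 1 (U m) := fun m => (hU m).mono (by norm_num)
  have T0 : Tendsto (fun m => Mass d n (U m)) atTop (nhds c) := by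
    rw [← hm]
    exact dct_sq hq A (fun m => (hU m).cont) (fun m z => (hb _ (hs m) (hs1 m) u hu.1 z).1)
      fun z => (hloc z).mono fun m h => h.eq_of_nhds
  have T1 : Tendsto (fun m => gradSq d n (U m)) atTop (nhds (gradSq d n u)) := by
    simp_rw [fun m => gradSq_eq (hU1 m), gradSq_eq' hu]
    refine tendsto_finsetSum _ fun k _ => ?_
    exact dct_sq hq A (fun m => ((hU1 m).D _).cont) (fun m z => (hb _ (hs m) (hs1 m) u hu.1 z).2.1 k)
      fun z => (hloc z).mono fun m h => (D_congr h _).eq_of_nhds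
  have T2 : Tendsto (fun m => lapSq d n (U m)) atTop (nhds (lapSq d n u)) := by
    refine dct_sq hq A (fun m => (hU m).lap.cont) (fun m z => (hb _ (hs m) (hs1 m) u hu.1 z).2.2)
      fun z => (hloc z).mono fun m h => ?_
    rw [lap_eq, lap_eq]
    exact Finset.sum_congr rfl fun k _ => (D_congr (D_congr h _) _).eq_of_nhds
  have pa : Continuous fun c : ℂ => ‖c‖^(α+2) := continuous_norm.rpow_const fun _ => Or.inr (by linarith)
  -- the scaling factor
  set t : ℕ → ℝ := fun m => √(c / Mass d n (U m))
  have Tt : Tendsto t atTop (nhds 1) := by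
    have h1 := (tendsto_const_nhds (x := c)).div T0 hc.ne'
    rw [div_self hc.ne'] at h1
    have h2 := (Real.continuous_sqrt.tendsto 1).comp h1
    rw [Real.sqrt_one] at h2
    exact h2
  have Tt2 : Tendsto (fun m => (t m)^2) atTop (nhds 1) := by simpa using Tt.pow 2
  have Tta : Tendsto (fun m => (t m)^(α+2)) atTop (nhds 1) := by
    simpa using Tt.rpow_const (p := α+2) (Or.inl one_ne_zero)
  have TQ : Tendsto (fun m => (t m)^2 * ((1/2) * lapSq d n (U m) + (β/2) * gradSq d n (U m))) atTop
      (nhds ((1/2) * lapSq d n u + (β/2) * gradSq d n u)) := by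
    simpa only [one_mul] using Tt2.mul ((T2.const_mul (1/2)).add (T1.const_mul (β/2)))
  have hpos : ∀ᶠ m in atTop, 0 < Mass d n (U m) := T0.eventually (lt_mem_nhds hc)
  have hfin : ∀ᶠ m in atTop, En d n β α (fun z => (t m : ℂ) * U m z) ≤ En d n β α u + ε := by
    suffices hh : ∀ᶠ m in atTop, (t m)^2 * ((1/2) * lapSq d n (U m) + (β/2) * gradSq d n (U m))
        - (t m)^(α+2) * ((1/(α+2)) * Npow d n (α+2) (U m)) ≤ En d n β α u + ε from
      hh.mono fun m h => (En_scale β α (hU m) (Real.sqrt_nonneg _ : 0 ≤ t m)).le.trans h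
    by_cases hi : Integrable (fun z => ‖u z‖^(α+2)) (μP d n)
    · have T3 : Tendsto (fun m => Npow d n (α+2) (U m)) atTop (nhds (Npow d n (α+2) u)) := by
        refine tendsto_integral_of_dominated_convergence _
          (fun m => (pa.comp (hU m).cont).aestronglyMeasurable) hi (fun m => ?_) ?_
        · filter_upwards with z
          rw [Real.norm_eq_abs, abs_of_nonneg (by positivity)]
          refine Real.rpow_le_rpow (norm_nonneg _) ?_ (by linarith)
          simp only [U, norm_mul]
          exact mul_le_of_le_one_left (norm_nonneg _) (eta_le _)
        · filter_upwards with z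
          refine tendsto_const_nhds.congr' ?_
          filter_upwards [hloc z] with m h
          rw [h.eq_of_nhds]
      have T4 := TQ.sub (Tta.mul (T3.const_mul (1/(α+2))))
      rw [one_mul] at T4
      have : En d n β α u < En d n β α u + ε := by linarith
      exact (T4.eventually (gt_mem_nhds this)).mono fun m h => h.le
    · have h0 : Npow d n (α+2) u = 0 := integral_undef hi
      have hE : (1/2) * lapSq d n u + (β/2) * gradSq d n u < En d n β α u + ε := by
        rw [En, h0]; linarith
      filter_upwards [TQ.eventually (gt_mem_nhds hE)] with m h
      have h1 : 0 ≤ Npow d n (α+2) (U m) := integral_nonneg fun z => by positivity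
      have h2 : 0 ≤ (t m)^(α+2) := Real.rpow_nonneg (Real.sqrt_nonneg _) _
      have h3 : 0 ≤ (t m)^(α+2) * (1/(α+2) * Npow d n (α+2) (U m)) := by positivity
      linarith
  obtain ⟨m, h1, h2⟩ := (hpos.and hfin).exists
  refine ⟨_, (hU m).const_mul _, ?_, h2⟩
  rw [mass_scale, Real.sq_sqrt (by positivity)]
  field_simp

lemma bddBelow_S {d n : ℕ} (hd : 1 ≤ d) (β : ℝ) {α c : ℝ} (hα : 0 < α) (hα' : α < 8 / ((d:ℝ)+n)) (hc : 0 < c) :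
    BddBelow (En d n β α '' Sset d n c) := by
  obtain ⟨C, hC⟩ := En_bd (n := n) hd β hα hα' hc
  refine ⟨C - 1, ?_⟩
  rintro _ ⟨u, ⟨hu, hm⟩, rfl⟩
  obtain ⟨v, hv, hvm, hve⟩ := trunc hu β hα hc hm one_pos
  have := hC v hv hvm.le
  linarith

lemma subadd {d n : ℕ} (hd : 1 ≤ d) (β : ℝ) {α c₁ c₂ : ℝ}
    (hα : 0 < α) (hα' : α < 8 / ((d:ℝ)+n)) (hc₁ : 0 < c₁) (hc₂ : 0 < c₂) :
    mC d n β α (c₁ + c₂) ≤ mC d n β α c₁ + mC d n β α c₂ := by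
  refine le_of_forall_pos_le_add fun ε hε => ?_
  have near : ∀ {c : ℝ}, 0 < c → ∃ v, Nice 2 v ∧ Mass d n v = c ∧ En d n β α v ≤ mC d n β α c + ε / 2 := by
    intro c hc
    obtain ⟨_, ⟨u, ⟨hu, hm⟩, rfl⟩, h⟩ := Real.lt_sInf_add_pos ((nonempty_S d n hc).image (En d n β α))
      (show 0 < ε / 4 by positivity)
    obtain ⟨v, hv, hvm, hve⟩ := trunc hu β hα hc hm (show 0 < ε / 4 by positivity)
    refine ⟨v, hv, hvm, ?_⟩
    rw [mC]; linarith
  obtain ⟨f, hf, hfm, hfe⟩ := near hc₁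
  obtain ⟨g, hg, hgm, hge⟩ := near hc₂
  obtain ⟨v, hv, hvm, hve⟩ := glue hd β hα hf hg
  have h1 : mC d n β α (c₁ + c₂) ≤ En d n β α v :=
    csInf_le (bddBelow_S hd β hα hα' (by positivity)) ⟨v, ⟨hv.inH2, by rw [hvm, hfm, hgm]⟩, rfl⟩
  linarith


end BNLS

open BNLS in
/-- subadditivity `m_{c₁+c₂} ≤ m_{c₁} + m_{c₂}`. -/
theorem stmt_7 (d n : ℕ) (hd : 1 ≤ d) (hn : 1 ≤ n) (β α c₁ c₂ : ℝ)
    (hα : 0 < α) (hα' : α < 8 / ((d:ℝ)+n)) (hc₁ : 0 < c₁) (hc₂ : 0 < c₂) :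
    mC d n β α (c₁ + c₂) ≤ mC d n β α c₁ + mC d n β α c₂ := by
  exact subadd hd β hα hα' hc₁ hc₂
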